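/- arXiv:1808.01131 — 2 statements merged into one kernel-verified Lean document; each statement's English description precedes it below -/
import Mathlib

section
/- Let X be an infinite-dimensional real Banach space and let 𝒥 : X → ℝ be a C¹ functional satisfying the Palais–Smale condition and the following hypotheses: (i) 𝒥(0) = 0 and there exist constants ρ, α > 0 such that 𝒥(u) ≥ α for every u ∈ X with ‖u‖ = ρ; (ii) 𝒥 is even, i.e. 𝒥(−u) = 𝒥(u) for all u ∈ X; (iii) for every finite-dimensional subspace X₀ ⊆ X there exists R = R(X₀) > 0 such that 𝒥(u) ≤ 0 for all u ∈ X₀ with ‖u‖ ≥ R. Then 𝒥 has an unbounded sequence of critical values; i.e., for every K > 0 there exists u ∈ X with 𝒥′(u) = 0 and 𝒥(u) ≥ K. -/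
open Filter

/-- A C¹ functional `J` on a real normed space satisfies the Palais–Smale condition if every
sequence along which `J` is bounded and `‖J'‖ → 0` admits a convergent subsequence. -/
def PalaisSmale {X : Type*} [NormedAddCommGroup X] [NormedSpace ℝ X] (J : X → ℝ) : Prop :=
  ∀ u : ℕ → X, (∃ C : ℝ, ∀ n, |J (u n)| ≤ C) →
    Tendsto (fun n => ‖fderiv ℝ J (u n)‖) atTop (nhds 0) →
    ∃ φ : ℕ → ℕ, StrictMono φ ∧ ∃ v : X, Tendsto (fun n => u (φ n)) atTop (nhds v)

namespace SMP

/-! ### Part 1: mod 2 chains of ordered simplices -/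

abbrev Ch (V : Type*) := List V →₀ ZMod 2

section chains
variable {V : Type*}

noncomputable def cone (v : V) : Ch V →ₗ[ZMod 2] Ch V :=
  Finsupp.lmapDomain _ _ (List.cons v)

@[simp] lemma cone_single (v : V) (l : List V) (a : ZMod 2) :
    cone v (Finsupp.single l a) = Finsupp.single (v :: l) a := by
  simp [cone, Finsupp.lmapDomain_apply, Finsupp.mapDomain_single]

noncomputable def bdL : List V → Ch V
  | [] => 0
  | v :: l => Finsupp.single l 1 + cone v (bdL l)

noncomputable def bd : Ch V →ₗ[ZMod 2] Ch V := Finsupp.linearCombination (ZMod 2) bdL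

@[simp] lemma bd_single (l : List V) : bd (Finsupp.single l 1) = bdL l := by
  simp [bd]

lemma ch_add_self {V : Type*} (c : Ch V) : c + c = 0 := by
  ext l; simp [CharTwo.add_self_eq_zero]

lemma bd_cone (v : V) (c : Ch V) : bd (cone v c) = c + cone v (bd c) := by
  have : bd ∘ₗ cone v = LinearMap.id + cone v ∘ₗ bd := by
    ext1 l
    ext1
    simp [bdL]
  exact LinearMap.congr_fun this c

lemma bd_bdL (l : List V) : bd (bdL l) = 0 := by
  induction l with
  | nil => simp [bdL]
  | cons v l ih =>
    simp [bdL, bd_cone, ih, ch_add_self]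

lemma bd_bd (c : Ch V) : bd (bd c) = 0 := by
  have : bd ∘ₗ bd = (0 : Ch V →ₗ[ZMod 2] Ch V) := by
    ext1 l
    ext1
    simp [bd_bdL]
  exact LinearMap.congr_fun this c

noncomputable def phi (q : V → ZMod 2) (M : Ch V →ₗ[ZMod 2] ZMod 2) : Ch V →ₗ[ZMod 2] ZMod 2 :=
  Finsupp.linearCombination (ZMod 2) (fun l : List V => match l with
    | [] => 0
    | v :: l => q v * M (Finsupp.single (v :: l) 1))

lemma phi_cone (q : V → ZMod 2) (M : Ch V →ₗ[ZMod 2] ZMod 2) (v : V) (c : Ch V) :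
    phi q M (cone v c) = q v * M (cone v c) := by
  have : phi q M ∘ₗ cone v = q v • (M ∘ₗ cone v) := by
    ext1 l
    ext1
    simp [phi]
  exact LinearMap.congr_fun this c

noncomputable def MM (p : ℕ → V → ZMod 2) : ℕ → (Ch V →ₗ[ZMod 2] ZMod 2)
  | 0 => Finsupp.linearCombination (ZMod 2) (fun l : List V => if l.length = 1 then 1 else 0)
  | j + 1 => phi (p j) (MM p j) ∘ₗ bd

lemma MM_zero_cone2 (p : ℕ → V → ZMod 2) (v w : V) (c : Ch V) :
    MM p 0 (cone v (cone w c)) = 0 := by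
  have : MM p 0 ∘ₗ cone v ∘ₗ cone w = 0 := by
    ext1 l
    ext1
    simp [MM]
  exact LinearMap.congr_fun this c

lemma MM_bd (p : ℕ → V → ZMod 2) (j : ℕ) (c : Ch V) : MM p j (bd c) = 0 := by
  cases j with
  | succ j => simp [MM, bd_bd]
  | zero =>
    have : MM p 0 ∘ₗ bd = 0 := by
      ext1 l
      ext1
      match l with
      | [] => simp [bdL]
      | [v] => simp [bdL, MM]
      | [v, w] => simp [bdL, MM, CharTwo.add_self_eq_zero]
      | v :: w :: x :: l =>
        simp only [LinearMap.comp_apply, Finsupp.lsingle_apply, bd_single, bdL, map_add,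
          MM_zero_cone2]
        simp [MM]
    exact LinearMap.congr_fun this c

lemma MM_succ_cons (p : ℕ → V → ZMod 2) (j : ℕ) (v w : V) (l : List V) :
    MM p (j + 1) (Finsupp.single (v :: w :: l) 1) =
      (p j v + p j w) * MM p j (Finsupp.single (w :: l) 1) := by
  have h := MM_bd p j (Finsupp.single (v :: w :: l) 1)
  rw [bd_single, bdL, map_add] at h
  have h2 : MM p j (cone v (bdL (w :: l))) = MM p j (Finsupp.single (w :: l) 1) := by
    exact (CharTwo.add_eq_zero.mp h).symm
  simp only [MM, LinearMap.comp_apply, bd_single]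
  rw [bdL, map_add, phi_cone, h2]
  simp [phi]
  ring

lemma MM_succ_nil (p : ℕ → V → ZMod 2) (j : ℕ) :
    MM p (j + 1) (Finsupp.single [] 1) = 0 := by
  simp [MM, bdL]

lemma MM_succ_one (p : ℕ → V → ZMod 2) (j : ℕ) (v : V) :
    MM p (j + 1) (Finsupp.single [v] 1) = 0 := by
  simp [MM, bdL, phi]

lemma MM_ne_zero (p : ℕ → V → ZMod 2) (j : ℕ) (l : List V)
    (h : MM p j (Finsupp.single l 1) ≠ 0) :
    ∀ i < j, ∃ v ∈ l, ∃ w ∈ l, p i v ≠ p i w := by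
  induction j generalizing l with
  | zero => intro i hi; omega
  | succ j ih =>
    match l with
    | [] => exact absurd (MM_succ_nil p j) h
    | [v] => exact absurd (MM_succ_one p j v) h
    | v :: w :: l =>
      rw [MM_succ_cons] at h
      intro i hi
      rcases Nat.lt_succ_iff_lt_or_eq.mp hi with h1 | h1
      · obtain ⟨a, ha, b, hb, hab⟩ := ih (w :: l) (right_ne_zero_of_mul h) i h1
        exact ⟨a, List.mem_cons_of_mem _ ha, b, List.mem_cons_of_mem _ hb, hab⟩
      · subst h1
        refine ⟨v, by simp, w, by simp, fun h' => left_ne_zero_of_mul h ?_⟩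
        rw [h', CharTwo.add_self_eq_zero]

/-- support of a chain -/
lemma lin_supported {s t : Set (List V)} (f : Ch V →ₗ[ZMod 2] Ch V)
    (hf : ∀ l ∈ s, f (Finsupp.single l 1) ∈ Finsupp.supported (ZMod 2) (ZMod 2) t)
    {c : Ch V} (hc : c ∈ Finsupp.supported (ZMod 2) (ZMod 2) s) :
    f c ∈ Finsupp.supported (ZMod 2) (ZMod 2) t := by
  rw [Finsupp.supported_eq_span_single] at hc
  induction hc using Submodule.span_induction with
  | mem x hx =>
    obtain ⟨l, hl, rfl⟩ := hx
    exact hf l hl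
  | zero => simp
  | add x y _ _ hx hy => rw [map_add]; exact add_mem hx hy
  | smul a x _ hx => rw [map_smul]; exact Submodule.smul_mem _ _ hx

lemma fun_supported_zero {s : Set (List V)} (f : Ch V →ₗ[ZMod 2] ZMod 2)
    (hf : ∀ l ∈ s, f (Finsupp.single l 1) = 0)
    {c : Ch V} (hc : c ∈ Finsupp.supported (ZMod 2) (ZMod 2) s) :
    f c = 0 := by
  rw [Finsupp.supported_eq_span_single] at hc
  induction hc using Submodule.span_induction with
  | mem x hx =>
    obtain ⟨l, hl, rfl⟩ := hx
    exact hf l hl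
  | zero => simp
  | add x y _ _ hx hy => rw [map_add, hx, hy, add_zero]
  | smul a x _ hx => rw [map_smul, hx, smul_zero]

lemma cone_supported {s t : Set (List V)} {v : V} (h : ∀ l ∈ s, v :: l ∈ t)
    {c : Ch V} (hc : c ∈ Finsupp.supported (ZMod 2) (ZMod 2) s) :
    cone v c ∈ Finsupp.supported (ZMod 2) (ZMod 2) t := by
  refine lin_supported _ (fun l hl => ?_) hc
  rw [cone_single]
  exact Finsupp.single_mem_supported _ _ (h l hl)

/-- faces of a list -/
lemma bdL_supported (l : List V) :
    bdL l ∈ Finsupp.supported (ZMod 2) (ZMod 2)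
      {t : List V | t.length + 1 = l.length ∧ ∀ x ∈ t, x ∈ l} := by
  induction l with
  | nil => simp [bdL]
  | cons v l ih =>
    rw [bdL]
    refine add_mem (Finsupp.single_mem_supported _ _ ?_) (cone_supported ?_ ih)
    · simp +contextual
    · rintro t ⟨h1, h2⟩
      simp only [Set.mem_ofPred_eq, List.length_cons, List.mem_cons, h1, true_and]
      rintro x (h | h)
      · exact Or.inl h
      · exact Or.inr (h2 x h)

end chains

section antip
variable {V : Type*} [AddCommGroup V]

noncomputable def TT : Ch V →ₗ[ZMod 2] Ch V :=
  Finsupp.lmapDomain _ _ (List.map (fun v : V => -v))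

@[simp] lemma TT_single (l : List V) (a : ZMod 2) :
    TT (Finsupp.single l a) = Finsupp.single (l.map (fun v : V => -v)) a := by
  simp [TT, Finsupp.lmapDomain_apply, Finsupp.mapDomain_single]

lemma TT_cone (v : V) (c : Ch V) : TT (cone v c) = cone (-v) (TT c) := by
  have : TT ∘ₗ cone v = cone (-v) ∘ₗ TT := by
    ext1 l
    ext1
    simp
  exact LinearMap.congr_fun this c

lemma TT_bdL (l : List V) : TT (bdL l) = bdL (l.map (fun v : V => -v)) := by
  induction l with
  | nil => simp [bdL]
  | cons v l ih => simp [bdL, TT_cone, ih]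

lemma bd_TT (c : Ch V) : bd (TT c) = TT (bd c) := by
  have : bd ∘ₗ TT = TT ∘ₗ (bd : Ch V →ₗ[ZMod 2] Ch V) := by
    ext1 l
    ext1
    simp [TT_bdL]
  exact LinearMap.congr_fun this c

lemma MM_TT (p : ℕ → V → ZMod 2) (h0 : ∀ v, p 0 (-v) = p 0 v)
    (hp : ∀ i v, v ≠ 0 → p (i + 1) (-v) = p (i + 1) v + 1) (j : ℕ) (l : List V)
    (hl : (0 : V) ∉ l) :
    MM p j (Finsupp.single (l.map (fun v : V => -v)) 1) = MM p j (Finsupp.single l 1) := by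
  induction j generalizing l with
  | zero => simp [MM]
  | succ j ih =>
    match l with
    | [] => simp
    | [v] => simp [MM_succ_one]
    | v :: w :: l =>
      simp only [List.map_cons]
      rw [MM_succ_cons, MM_succ_cons]
      have hv : v ≠ 0 := fun h => hl (by simp [h])
      have hw : w ≠ 0 := fun h => hl (by simp [h])
      have h1 := ih (w :: l) (fun h => hl (List.mem_cons_of_mem _ h))
      simp only [List.map_cons] at h1
      rw [h1]
      congr 1
      cases j with
      | zero => rw [h0, h0]
      | succ j =>
        rw [hp j v hv, hp j w hw]
        have : (1 : ZMod 2) + 1 = 0 := by decide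
        linear_combination this

/-- The inductive parity step. -/
lemma parity_step (p : ℕ → V → ZMod 2) (h0 : ∀ v, p 0 (-v) = p 0 v)
    (hp : ∀ i v, v ≠ 0 → p (i + 1) (-v) = p (i + 1) v + 1) (j : ℕ)
    (D D' O : Ch V) (hbd : bd D' = D + TT D + O)
    (hO : O ∈ Finsupp.supported (ZMod 2) (ZMod 2) {l : List V | ∀ v ∈ l, p 0 v = 0})
    (hD : D ∈ Finsupp.supported (ZMod 2) (ZMod 2)
      {l : List V | (0 : V) ∈ l → ∀ v ∈ l, p 0 v = 1}) :
    MM p (j + 2) D' = MM p (j + 1) D := by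
  have e1 : MM p (j + 2) D' = phi (p (j + 1)) (MM p (j + 1)) (bd D') := rfl
  rw [e1, hbd, map_add, map_add]
  have e2 : phi (p (j + 1)) (MM p (j + 1)) O = 0 := by
    refine fun_supported_zero _ (fun l hl => ?_) hO
    match l with
    | [] => simp [phi]
    | v :: l =>
      have : MM p (j + 1) (Finsupp.single (v :: l) 1) = 0 := by
        by_contra h
        obtain ⟨a, ha, b, hb, hab⟩ := MM_ne_zero p _ _ h 0 (by omega)
        exact hab (by rw [hl a ha, hl b hb])
      simp [phi, this]
  rw [e2, add_zero]
  have e3 : (phi (p (j + 1)) (MM p (j + 1)) + phi (p (j + 1)) (MM p (j + 1)) ∘ₗ TT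
      - MM p (j + 1)) D = 0 := by
    refine fun_supported_zero _ (fun l hl => ?_) hD
    match l with
    | [] => simp [phi, MM_succ_nil]
    | v :: l =>
      by_cases hz : (0 : V) ∈ v :: l
      · have hl := hl hz
        have h1 : MM p (j + 1) (Finsupp.single (v :: l) 1) = 0 := by
          by_contra h
          obtain ⟨a, ha, b, hb, hab⟩ := MM_ne_zero p _ _ h 0 (by omega)
          exact hab (by rw [hl a ha, hl b hb])
        have h2 : MM p (j + 1) (Finsupp.single ((v :: l).map (fun v : V => -v)) 1) = 0 := by
          by_contra h
          obtain ⟨a, ha, b, hb, hab⟩ := MM_ne_zero p _ _ h 0 (by omega)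
          obtain ⟨a, ha', rfl⟩ := List.mem_map.mp ha
          obtain ⟨b, hb', rfl⟩ := List.mem_map.mp hb
          exact hab (by rw [h0, h0, hl a ha', hl b hb'])
        simp only [List.map_cons] at h2
        simp [phi, h1, h2]
      · have h2 := MM_TT p h0 hp (j + 1) (v :: l) hz
        simp only [List.map_cons] at h2
        have hv : v ≠ 0 := fun h => hz (by simp [h])
        simp only [LinearMap.sub_apply, LinearMap.add_apply, LinearMap.comp_apply, TT_single,
          List.map_cons]
        simp only [phi, Finsupp.linearCombination_single, one_smul, h2, hp j v hv]
        have : (1 : ZMod 2) + 1 = 0 := by decide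
        linear_combination (p (j + 1) v * MM p (j + 1) (Finsupp.single (v :: l) 1)) * this
  simp only [LinearMap.sub_apply, LinearMap.add_apply, LinearMap.comp_apply] at e3
  exact sub_eq_zero.mp e3

end antip
end SMP

namespace SMP
section subdiv
variable {V : Type*} [NormedAddCommGroup V] [NormedSpace ℝ V]

noncomputable def bary (l : List V) : V := (l.length : ℝ)⁻¹ • l.sum

lemma bary_neg (l : List V) : bary (l.map (fun v : V => -v)) = - bary l := by
  have : (l.map (fun v : V => -v)).sum = - l.sum := by
    induction l with
    | nil => simp
    | cons v l ih => simp only [List.map_cons, List.sum_cons, ih]; abel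
  simp [bary, this]

noncomputable def sd : ℕ → (Ch V →ₗ[ZMod 2] Ch V)
  | 0 => LinearMap.id
  | n + 1 => Finsupp.linearCombination (ZMod 2) (fun l => cone (bary l) (sd n (bdL l)))

lemma sd_succ_single (n : ℕ) (l : List V) :
    sd (n + 1) (Finsupp.single l 1) = cone (bary l) (sd n (bdL l)) := by
  simp [sd]

lemma bd_sd (n : ℕ) (c : Ch V) : bd (sd (n + 1) c) = sd n (bd c) := by
  suffices h : bd ∘ₗ sd (n + 1) = sd n ∘ₗ (bd : Ch V →ₗ[ZMod 2] Ch V) from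
    LinearMap.congr_fun h c
  induction n with
  | zero =>
    ext1 l
    ext1
    simp only [LinearMap.comp_apply, Finsupp.lsingle_apply, sd_succ_single, bd_cone, bd_single]
    simp [sd, bd_bdL]
  | succ n ih =>
    ext1 l
    ext1
    have := LinearMap.congr_fun ih (bdL l)
    simp only [LinearMap.comp_apply] at this
    simp only [LinearMap.comp_apply, Finsupp.lsingle_apply, sd_succ_single n.succ, bd_cone,
      bd_single]
    rw [this, bd_bdL]
    simp

lemma sd_TT (n : ℕ) (c : Ch V) : sd n (TT c) = TT (sd n c) := by
  suffices h : sd n ∘ₗ TT = TT ∘ₗ (sd n : Ch V →ₗ[ZMod 2] Ch V) from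
    LinearMap.congr_fun h c
  induction n with
  | zero => rfl
  | succ n ih =>
    ext1 l
    ext1
    have := LinearMap.congr_fun ih (bdL l)
    simp only [LinearMap.comp_apply] at this
    simp only [LinearMap.comp_apply, Finsupp.lsingle_apply, sd_succ_single, TT_single, bary_neg,
      TT_cone, ← this, TT_bdL]

lemma bary_mem {C : Set V} (hC : Convex ℝ C) (l : List V) (hl : l ≠ []) (h : ∀ x ∈ l, x ∈ C) :
    bary l ∈ C := by
  have hn : (0 : ℝ) < l.length := by
    exact_mod_cast List.length_pos_iff.mpr hl
  have : bary l = ∑ i : Fin l.length, (l.length : ℝ)⁻¹ • l.get i := by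
    rw [← Finset.smul_sum, bary]
    congr 1
    conv_lhs => rw [← List.ofFn_get l]
    rw [List.sum_ofFn]
  rw [this]
  apply hC.sum_mem
  · intro i _; positivity
  · simp [hn.ne']
  · intro i _; exact h _ (List.get_mem _ _)

lemma norm_list_sum_sub (l : List V) (v : V) {δ : ℝ} (hδ : ∀ x ∈ l, dist x v ≤ δ) :
    ‖l.sum - (l.length : ℝ) • v‖ ≤ l.length * δ := by
  induction l with
  | nil => simp
  | cons a l ih =>
    have h1 := ih (fun x hx => hδ x (List.mem_cons_of_mem _ hx))
    have h2 := hδ a (by simp)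
    rw [dist_eq_norm] at h2
    have : (a :: l).sum - ((a :: l).length : ℝ) • v
        = (a - v) + (l.sum - (l.length : ℝ) • v) := by
      simp only [List.sum_cons, List.length_cons, Nat.cast_add, Nat.cast_one, add_smul, one_smul]
      abel
    rw [this]
    refine (norm_add_le _ _).trans ?_
    simp only [List.length_cons, Nat.cast_add, Nat.cast_one]
    linarith

lemma norm_list_sum_sub' (l : List V) (v : V) (hv : v ∈ l) {δ : ℝ}
    (hδ : ∀ x ∈ l, dist x v ≤ δ) :
    ‖l.sum - (l.length : ℝ) • v‖ ≤ (l.length - 1) * δ := by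
  obtain ⟨s, t, rfl⟩ := List.append_of_mem hv
  have h1 := norm_list_sum_sub s v (δ := δ) (fun x hx => hδ x (by simp [hx]))
  have h2 := norm_list_sum_sub t v (δ := δ) (fun x hx => hδ x (by simp [hx]))
  have : (s ++ v :: t).sum - ((s ++ v :: t).length : ℝ) • v
      = (s.sum - (s.length : ℝ) • v) + (t.sum - (t.length : ℝ) • v) := by
    simp only [List.sum_append, List.sum_cons, List.length_append, List.length_cons,
      Nat.cast_add, Nat.cast_one, add_smul, one_smul]
    abel
  rw [this]
  refine (norm_add_le _ _).trans ?_
  simp only [List.length_append, List.length_cons, Nat.cast_add, Nat.cast_one]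
  linarith

lemma dist_bary (l : List V) {m : ℕ} (hm : l.length ≤ m) {δ : ℝ} (h0 : 0 ≤ δ) (v : V) (hv : v ∈ l)
    (hδ : ∀ x ∈ l, dist x v ≤ δ) : dist v (bary l) ≤ (1 - (m : ℝ)⁻¹) * δ := by
  have hn' : 0 < l.length := List.length_pos_iff.mpr (List.ne_nil_of_mem hv)
  have hn : (0 : ℝ) < l.length := by exact_mod_cast hn'
  have h1 := norm_list_sum_sub' l v hv hδ
  have e : bary l - v = (l.length : ℝ)⁻¹ • (l.sum - (l.length : ℝ) • v) := by
    rw [smul_sub, smul_smul, inv_mul_cancel₀ hn.ne', one_smul, bary]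
  rw [dist_comm, dist_eq_norm, e, norm_smul, Real.norm_of_nonneg (by positivity)]
  calc (l.length : ℝ)⁻¹ * ‖l.sum - (l.length : ℝ) • v‖
      ≤ (l.length : ℝ)⁻¹ * ((l.length - 1) * δ) := by gcongr
    _ = (1 - (l.length : ℝ)⁻¹) * δ := by field_simp
    _ ≤ (1 - (m : ℝ)⁻¹) * δ := by
        gcongr

def GG (n : ℕ) (C : Set V) (δ : ℝ) : Set (List V) :=
  {t | t.length = n ∧ (∀ x ∈ t, x ∈ C) ∧ ∀ x ∈ t, ∀ y ∈ t, dist x y ≤ δ}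

lemma sd_single_supported (m : ℕ) (hm : 1 ≤ m) (n : ℕ) (hn : n ≤ m) {δ : ℝ} (h0 : 0 ≤ δ)
    (C : Set V) (hC : Convex ℝ C) (l : List V) (hl : l ∈ GG n C δ) :
    sd n (Finsupp.single l 1) ∈ Finsupp.supported (ZMod 2) (ZMod 2)
      (GG n C ((1 - (m : ℝ)⁻¹) * δ)) := by
  have hm1 : 0 ≤ (1 - (m : ℝ)⁻¹) := by
    have : (m : ℝ)⁻¹ ≤ 1 := inv_le_one_of_one_le₀ (by exact_mod_cast hm)
    linarith
  induction n generalizing l C with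
  | zero =>
    obtain ⟨h1, h2, h3⟩ := hl
    have : l = [] := List.length_eq_zero_iff.mp h1
    subst this
    exact Finsupp.single_mem_supported _ _ ⟨rfl, by simp, by simp⟩
  | succ n ih =>
    rw [sd_succ_single]
    obtain ⟨h1, h2, h3⟩ := hl
    have hne : l ≠ [] := by rintro rfl; simp at h1
    set H := convexHull ℝ {x | x ∈ l} with hH
    have hHC : H ⊆ C := convexHull_min h2 hC
    have hb : bary l ∈ H := bary_mem (convex_convexHull ℝ _) l hne
      (fun x hx => subset_convexHull ℝ _ hx)
    have key : sd n (bdL l) ∈ Finsupp.supported (ZMod 2) (ZMod 2)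
        (GG n H ((1 - (m : ℝ)⁻¹) * δ)) := by
      refine lin_supported _ (fun t ht => ?_) (bdL_supported l)
      refine ih (by omega) H (convex_convexHull ℝ _) t ⟨by have := ht.1; omega, ?_, ?_⟩
      · intro x hx
        exact subset_convexHull ℝ _ (ht.2 x hx)
      · intro x hx y hy
        exact h3 x (ht.2 x hx) y (ht.2 y hy)
    refine cone_supported (fun t ht => ?_) key
    obtain ⟨t1, t2, t3⟩ := ht
    have hd : ∀ x ∈ H, dist x (bary l) ≤ (1 - (m : ℝ)⁻¹) * δ := by
      have : H ⊆ Metric.closedBall (bary l) ((1 - (m : ℝ)⁻¹) * δ) := by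
        refine convexHull_min (fun v hv => ?_) (convex_closedBall _ _)
        exact dist_bary l (by omega) h0 v hv (fun x hx => h3 x hx v hv)
      exact fun x hx => this hx
    refine ⟨by simp [t1], ?_, ?_⟩
    · intro x hx
      rcases List.mem_cons.mp hx with rfl | hx
      · exact hHC hb
      · exact hHC (t2 x hx)
    · intro x hx y hy
      rcases List.mem_cons.mp hx with rfl | hx <;> rcases List.mem_cons.mp hy with rfl | hy
      · rw [dist_self]; positivity
      · rw [dist_comm]; exact hd y (t2 y hy)
      · exact hd x (t2 x hx)
      · exact t3 x hx y hy

noncomputable def SD (n N : ℕ) : Ch V →ₗ[ZMod 2] Ch V := (sd n : Module.End (ZMod 2) (Ch V)) ^ N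

lemma SD_succ (n N : ℕ) (c : Ch V) : SD n (N + 1) c = sd n (SD n N c) := by
  simp [SD, pow_succ']

lemma SD_zero (n : ℕ) (c : Ch V) : SD n 0 c = c := by simp [SD]

lemma bd_SD (n N : ℕ) (c : Ch V) : bd (SD (n + 1) N c) = SD n N (bd c) := by
  induction N with
  | zero => simp [SD_zero]
  | succ N ih => rw [SD_succ, SD_succ, bd_sd, ih]

lemma SD_TT (n N : ℕ) (c : Ch V) : SD n N (TT c) = TT (SD n N c) := by
  induction N with
  | zero => simp [SD_zero]
  | succ N ih => rw [SD_succ, SD_succ, ih, sd_TT]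

lemma SD_one_single (N : ℕ) (v : V) : SD 1 N (Finsupp.single [v] 1) = Finsupp.single [v] 1 := by
  induction N with
  | zero => simp [SD_zero]
  | succ N ih =>
    rw [SD_succ, ih, sd_succ_single]
    simp [bdL, sd, bary]

lemma SD_single_supported (m : ℕ) (hm : 1 ≤ m) (n : ℕ) (hn : n ≤ m) {δ : ℝ} (h0 : 0 ≤ δ)
    (C : Set V) (hC : Convex ℝ C) (N : ℕ) (l : List V) (hl : l ∈ GG n C δ) :
    SD n N (Finsupp.single l 1) ∈ Finsupp.supported (ZMod 2) (ZMod 2)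
      (GG n C ((1 - (m : ℝ)⁻¹) ^ N * δ)) := by
  have hm1 : 0 ≤ (1 - (m : ℝ)⁻¹) := by
    have : (m : ℝ)⁻¹ ≤ 1 := inv_le_one_of_one_le₀ (by exact_mod_cast hm)
    linarith
  induction N with
  | zero => rw [SD_zero]; simpa using Finsupp.single_mem_supported _ _ hl
  | succ N ih =>
    rw [SD_succ]
    refine lin_supported _ (fun t ht => ?_) ih
    have := sd_single_supported m hm n hn (by positivity) C hC t ht
    rwa [← mul_assoc, ← pow_succ'] at this

end subdiv

section coarse
variable {V : Type*} [AddCommGroup V]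

noncomputable def ss (e : ℕ → V) : ℕ → Ch V
  | 0 => Finsupp.single [] 1
  | j + 1 => cone (e j) (ss e j) + TT (cone (e j) (ss e j))

noncomputable def uu (e : ℕ → V) (j : ℕ) : Ch V := cone (e j) (ss e j)

noncomputable def dd (e : ℕ → V) (j : ℕ) : Ch V := cone 0 (uu e j)

lemma TT_TT (c : Ch V) : TT (TT c) = c := by
  have : TT ∘ₗ TT = (LinearMap.id : Ch V →ₗ[ZMod 2] Ch V) := by
    ext1 l
    ext1
    simp [Function.comp_def]
  exact LinearMap.congr_fun this c

lemma TT_ss (e : ℕ → V) (j : ℕ) : TT (ss e j) = ss e j := by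
  cases j with
  | zero => simp [ss]
  | succ j => simp only [ss, map_add, TT_TT]; abel

lemma bd_ss (e : ℕ → V) (j : ℕ) : bd (ss e j) = 0 := by
  induction j with
  | zero => simp [ss, bdL]
  | succ j ih => simp only [ss, map_add, bd_TT, bd_cone, ih, TT_ss, map_zero, add_zero,
      ch_add_self]

lemma bd_uu (e : ℕ → V) (j : ℕ) : bd (uu e j) = ss e j := by
  simp [uu, bd_cone, bd_ss]

lemma bd_dd_zero (e : ℕ → V) :
    bd (dd e 0) = Finsupp.single [e 0] 1 + Finsupp.single [0] 1 := by
  simp [dd, uu, ss, bdL]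

lemma bd_dd_succ (e : ℕ → V) (j : ℕ) :
    bd (dd e (j + 1)) = dd e j + TT (dd e j) + uu e (j + 1) := by
  rw [dd, bd_cone, bd_uu, ss, map_add, dd, uu, uu]
  simp only [TT_cone, neg_zero]
  abel

end coarse
end SMP

namespace SMP
section bu

def ee (m : ℕ) (A : ℝ) (j : ℕ) : Fin m → ℝ := fun i => if i.val = j then A else 0

def HS (m : ℕ) (A : ℝ) (j : ℕ) : Set (List (Fin m → ℝ)) :=
  {l | l.length = j ∧ (∀ x ∈ l, ‖x‖ ≤ A) ∧ ∃ ε : Fin m → ℝ, (∀ i, |ε i| ≤ 1) ∧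
    ∀ v ∈ l, A ≤ ∑ i, ε i * v i ∧ ∀ i : Fin m, j ≤ i.val → v i = 0}

lemma HS_cons (m : ℕ) {A : ℝ} (hA : 0 ≤ A) (j : ℕ) (hj : j < m) (l : List (Fin m → ℝ))
    (hl : l ∈ HS m A j) : ee m A j :: l ∈ HS m A (j + 1) := by
  obtain ⟨h1, h2, ε, h3, h4⟩ := hl
  refine ⟨by simp [h1], ?_, Function.update ε ⟨j, hj⟩ 1, ?_, ?_⟩
  · intro x hx
    rcases List.mem_cons.mp hx with rfl | hx
    · rw [pi_norm_le_iff_of_nonneg hA]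
      intro i
      unfold ee
      split_ifs
      · rw [Real.norm_of_nonneg hA]
      · simpa using hA
    · exact h2 x hx
  · intro i
    by_cases hi : i = ⟨j, hj⟩
    · subst hi; simp
    · simp [Function.update_of_ne hi, h3]
  · intro v hv
    rcases List.mem_cons.mp hv with rfl | hv
    · constructor
      · rw [Finset.sum_eq_single ⟨j, hj⟩]
        · simp [ee]
        · intro b _ hb
          have : b.val ≠ j := fun h => hb (Fin.ext h)
          simp [ee, this]
        · simp
      · intro i hi
        have : i.val ≠ j := by omega
        simp [ee, this]
    · obtain ⟨h5, h6⟩ := h4 v hv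
      refine ⟨h5.trans_eq (Finset.sum_congr rfl fun i _ => ?_), fun i hi => h6 i (by omega)⟩
      by_cases hi : i = ⟨j, hj⟩
      · rw [hi, h6 ⟨j, hj⟩ le_rfl]; simp
      · rw [Function.update_of_ne hi]

lemma HS_neg (m : ℕ) {A : ℝ} (j : ℕ) (l : List (Fin m → ℝ))
    (hl : l ∈ HS m A j) : l.map (fun v => -v) ∈ HS m A j := by
  obtain ⟨h1, h2, ε, h3, h4⟩ := hl
  refine ⟨by simp [h1], ?_, -ε, ?_, ?_⟩
  · intro x hx
    obtain ⟨y, hy, rfl⟩ := List.mem_map.mp hx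
    rw [norm_neg]; exact h2 y hy
  · intro i; simpa using h3 i
  · intro x hx
    obtain ⟨y, hy, rfl⟩ := List.mem_map.mp hx
    obtain ⟨h5, h6⟩ := h4 y hy
    refine ⟨by simpa using h5, fun i hi => by simp [h6 i hi]⟩

lemma ss_supported (m : ℕ) {A : ℝ} (hA : 0 ≤ A) (j : ℕ) (hj : j ≤ m) :
    ss (ee m A) j ∈ Finsupp.supported (ZMod 2) (ZMod 2) (HS m A j) := by
  induction j with
  | zero =>
    exact Finsupp.single_mem_supported _ _ ⟨rfl, by simp, 0, by simp, by simp⟩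
  | succ j ih =>
    have hu : cone (ee m A j) (ss (ee m A) j) ∈
        Finsupp.supported (ZMod 2) (ZMod 2) (HS m A (j + 1)) :=
      cone_supported (fun l hl => HS_cons m hA j hj l hl) (ih (by omega))
    refine add_mem hu (lin_supported _ (fun l hl => ?_) hu)
    rw [TT_single]
    exact Finsupp.single_mem_supported _ _ (HS_neg m _ l hl)

lemma uu_supported (m : ℕ) {A : ℝ} (hA : 0 ≤ A) (j : ℕ) (hj : j < m) :
    uu (ee m A) j ∈ Finsupp.supported (ZMod 2) (ZMod 2) (HS m A (j + 1)) :=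
  cone_supported (fun l hl => HS_cons m hA j hj l hl) (ss_supported m hA j hj.le)

lemma dd_supported (m : ℕ) {A : ℝ} (hA : 0 ≤ A) (j : ℕ) (hj : j < m) :
    dd (ee m A) j ∈ Finsupp.supported (ZMod 2) (ZMod 2)
      (GG (j + 2) (Metric.closedBall 0 A) (2 * A)) := by
  refine cone_supported (fun l hl => ?_) (uu_supported m hA j hj)
  obtain ⟨h1, h2, -⟩ := hl
  have h3 : ∀ x ∈ (0 : Fin m → ℝ) :: l, ‖x‖ ≤ A := by
    intro x hx
    rcases List.mem_cons.mp hx with rfl | hx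
    · simpa using hA
    · exact h2 x hx
  refine ⟨by simp [h1], fun x hx => by simpa using h3 x hx, fun x hx y hy => ?_⟩
  rw [dist_eq_norm]
  have := norm_sub_le x y
  have := h3 x hx
  have := h3 y hy
  linarith

theorem comb_BU (k : ℕ) (p : ℕ → (Fin (k + 1) → ℝ) → ZMod 2) (h0 : ∀ v, p 0 (-v) = p 0 v)
    (hp : ∀ i v, v ≠ 0 → p (i + 1) (-v) = p (i + 1) v + 1) (R : ℝ) (hR : 0 < R)
    (hout : ∀ x, R ≤ ‖x‖ → p 0 x = 0) (r : ℝ) (hr : 0 < r) (hin : ∀ x, ‖x‖ < r → p 0 x = 1)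
    (ε : ℝ) (hε : 0 < ε) :
    ∃ l : List (Fin (k + 1) → ℝ), (∀ x ∈ l, ‖x‖ ≤ (k + 1) * R) ∧
      (∀ x ∈ l, ∀ y ∈ l, dist x y < ε) ∧ ∀ i < k + 1, ∃ v ∈ l, ∃ w ∈ l, p i v ≠ p i w := by
  set A : ℝ := (k + 1) * R with hAdef
  have hA : 0 < A := by positivity
  set θ : ℝ := 1 - ((k + 2 : ℕ) : ℝ)⁻¹ with hθ
  have hθ1 : θ < 1 := by
    have : (0 : ℝ) < ((k + 2 : ℕ) : ℝ)⁻¹ := by positivity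
    linarith
  have hθ0 : 0 ≤ θ := by
    have : ((k + 2 : ℕ) : ℝ)⁻¹ ≤ 1 := inv_le_one_of_one_le₀ (by norm_cast; omega)
    linarith
  obtain ⟨N, hN⟩ : ∃ N : ℕ, θ ^ N * (2 * A) < min ε r := by
    obtain ⟨N, hN⟩ := exists_pow_lt_of_lt_one (show 0 < min ε r / (2 * A) by positivity) hθ1
    exact ⟨N, (lt_div_iff₀ (by positivity)).mp hN⟩
  set e := ee (k + 1) A with he
  have hDs : ∀ j < k + 1, SD (j + 2) N (dd e j) ∈ Finsupp.supported (ZMod 2) (ZMod 2)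
      (GG (j + 2) (Metric.closedBall 0 A) (θ ^ N * (2 * A))) := by
    intro j hj
    refine lin_supported _ (fun l hl => ?_) (dd_supported (k + 1) hA.le j hj)
    exact SD_single_supported (k + 2) (by omega) (j + 2) (by omega) (by positivity) _
      (convex_closedBall _ _) N l hl
  have hOs : ∀ j < k + 1, SD (j + 1) N (uu e j) ∈ Finsupp.supported (ZMod 2) (ZMod 2)
      {l : List (Fin (k + 1) → ℝ) | ∀ v ∈ l, p 0 v = 0} := by
    intro j hj
    refine lin_supported _ (fun l hl => ?_) (uu_supported (k + 1) hA.le j hj)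
    obtain ⟨h1, h2, η, h3, h4⟩ := hl
    set C : Set (Fin (k + 1) → ℝ) := {v | A ≤ ∑ i, η i * v i} with hC
    have hCc : Convex ℝ C := by
      refine convex_halfSpace_ge (f := fun v : Fin (k + 1) → ℝ => ∑ i, η i * v i) ⟨?_, ?_⟩ A
      · intro x y; simp [mul_add, Finset.sum_add_distrib]
      · intro c x; simp [Finset.mul_sum, mul_left_comm]
    have := SD_single_supported (k + 2) (by omega) (j + 1) (by omega)
      (show 0 ≤ 2 * A by positivity) C hCc N l ⟨h1, fun v hv => (h4 v hv).1, fun x hx y hy => by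
        rw [dist_eq_norm]
        have := norm_sub_le x y
        have := h2 x hx
        have := h2 y hy
        linarith⟩
    refine Finsupp.supported_mono ?_ this
    rintro t ⟨-, ht, -⟩ v hv
    apply hout
    have h5 : A ≤ ∑ i, η i * v i := ht v hv
    have h6 : ∑ i, η i * v i ≤ ∑ i : Fin (k + 1), ‖v‖ := by
      refine Finset.sum_le_sum fun i _ => ?_
      calc η i * v i ≤ |η i * v i| := le_abs_self _
        _ = |η i| * ‖v i‖ := by rw [abs_mul, Real.norm_eq_abs]
        _ ≤ 1 * ‖v‖ := by
          gcongr
          · exact h3 i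
          · exact norm_le_pi_norm v i
        _ = ‖v‖ := one_mul _
    simp only [Finset.sum_const, Finset.card_univ, Fintype.card_fin, nsmul_eq_mul,
      Nat.cast_add, Nat.cast_one] at h6
    have h7 : ((k : ℝ) + 1) * R ≤ (k + 1) * ‖v‖ := by linarith
    exact le_of_mul_le_mul_left h7 (by positivity)
  have hpar : ∀ j < k + 1, MM p (j + 1) (SD (j + 2) N (dd e j)) = 1 := by
    intro j
    induction j with
    | zero =>
      intro _
      have e1 : MM p (0 + 1) (SD (0 + 2) N (dd e 0))
        = phi (p 0) (MM p 0) (bd (SD (0 + 2) N (dd e 0))) := rfl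
      have h8 : p 0 (e 0) = 0 := by
        apply hout
        have h9 : ‖e 0 0‖ ≤ ‖e 0‖ := norm_le_pi_norm _ _
        have h10 : e 0 0 = A := by simp [he, ee]
        rw [h10, Real.norm_of_nonneg hA.le] at h9
        refine le_trans ?_ h9
        rw [hAdef]
        have : (0 : ℝ) ≤ k := by positivity
        nlinarith
      have h11 : p 0 0 = 1 := hin 0 (by simpa using hr)
      rw [e1, bd_SD, bd_dd_zero, map_add, SD_one_single, SD_one_single]
      simp [phi, MM, h8, h11]
    | succ j ih =>
      intro hj
      rw [← ih (by omega)]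
      refine parity_step p h0 hp j _ _ (SD (j + 2) N (uu e (j + 1))) ?_ (hOs (j + 1) hj) ?_
      · rw [bd_SD, bd_dd_succ, map_add, map_add, SD_TT]
      · refine Finsupp.supported_mono ?_ (hDs j (by omega))
        rintro t ⟨-, -, ht⟩ h0t v hv
        apply hin
        have := ht v hv 0 h0t
        rw [dist_zero_right] at this
        exact this.trans_lt (hN.trans_le (min_le_right _ _))
  have hfin := hpar k (by omega)
  by_contra hcon
  have : MM p (k + 1) (SD (k + 2) N (dd e k)) = 0 := by
    refine fun_supported_zero _ (fun l hl => ?_) (hDs k (by omega))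
    by_contra hne
    refine hcon ⟨l, fun x hx => by simpa using hl.2.1 x hx, fun x hx y hy => ?_,
      MM_ne_zero p _ _ hne⟩
    exact (hl.2.2 x hx y hy).trans_lt (hN.trans_le (min_le_left _ _))
  rw [this] at hfin
  exact absurd hfin (by decide)

open Classical in
theorem strong_BU (k : ℕ) (g : (Fin (k + 1) → ℝ) → ℝ) (ψ : ℕ → (Fin (k + 1) → ℝ) → ℝ)
    (hg : Continuous g) (hψ : ∀ i, Continuous (ψ i)) (hge : ∀ x, g (-x) = g x)
    (hψo : ∀ i x, ψ i (-x) = - ψ i x) (hg0 : g 0 < 0) (R : ℝ)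
    (hR : ∀ x, R ≤ ‖x‖ → 0 < g x) : ∃ x, g x = 0 ∧ ∀ i < k, ψ i x = 0 := by
  have hRpos : 0 < R := by
    by_contra h
    have := hR 0 (by simpa using h)
    linarith
  let F : ℕ → (Fin (k + 1) → ℝ) → ℝ := fun i => match i with
    | 0 => fun x => - g x
    | i + 1 => ψ i
  have hF : ∀ i, Continuous (F i) := by
    intro i
    cases i with
    | zero => exact hg.neg
    | succ i => exact hψ i
  let p : ℕ → (Fin (k + 1) → ℝ) → ZMod 2 := fun i => match i with
    | 0 => fun x => if g x < 0 then 1 else 0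
    | i + 1 => fun x => if 0 < ψ i x ∨ (ψ i x = 0 ∧ WellOrderingRel x (-x)) then 1 else 0
  have hp1 : ∀ i x, p i x = 1 → 0 ≤ F i x := by
    intro i x
    cases i with
    | zero =>
      simp only [p, F]
      split_ifs with h
      · intro _; linarith
      · simp
    | succ i =>
      simp only [p, F]
      split_ifs with h
      · intro _; rcases h with h | h
        · exact h.le
        · exact h.1.ge
      · simp
  have hp0 : ∀ i x, p i x = 0 → F i x ≤ 0 := by
    intro i x
    cases i with
    | zero =>
      simp only [p, F]
      split_ifs with h
      · simp
      · intro _; linarith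
    | succ i =>
      simp only [p, F]
      split_ifs with h
      · simp
      · intro _
        by_contra h'
        exact h (Or.inl (not_le.mp h'))
  obtain ⟨r, hr, hrin⟩ : ∃ r > 0, ∀ x, ‖x‖ < r → g x < 0 := by
    have : ∀ᶠ x in nhds 0, g x < 0 := hg.continuousAt.eventually (gt_mem_nhds hg0)
    obtain ⟨r, hr, h⟩ := Metric.eventually_nhds_iff.mp this
    exact ⟨r, hr, fun x hx => h (by simpa using hx)⟩
  have key := fun ε hε => comb_BU k p (fun v => by simp only [p, hge])
    (by
      intro i v hv
      have hvn : v ≠ -v := by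
        intro h
        exact hv (self_eq_neg.mp h)
      simp only [p, hψo, neg_neg]
      rcases lt_trichotomy (ψ i v) 0 with h | h | h
      · have h1 : ¬ (0 < ψ i v) := by linarith
        have h2 : ¬ (ψ i v = 0) := h.ne
        simp [h, h1, h2]
      · simp only [h, neg_zero, lt_irrefl, true_and, false_or]
        rcases trichotomous_of WellOrderingRel v (-v) with h1 | h1 | h1
        · have h2 : ¬ WellOrderingRel (-v) v := asymm_of WellOrderingRel h1
          simp only [h1, h2, if_true, if_false]; decide
        · exact absurd h1 hvn
        · have h2 : ¬ WellOrderingRel v (-v) := asymm_of WellOrderingRel h1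
          simp only [h1, h2, if_true, if_false]; decide
      · have h1 : ¬ (ψ i v < 0) := by linarith
        have h2 : ¬ (ψ i v = 0) := h.ne'
        simp only [h, h1, h2, Left.neg_pos_iff, neg_eq_zero, false_and, or_false, if_true, if_false]
        decide) R hRpos
    (fun x hx => by simp only [p]; rw [if_neg]; linarith [hR x hx]) r hr
    (fun x hx => by simp only [p]; rw [if_pos (hrin x hx)]) ε hε
  have hkey : ∀ n : ℕ, ∃ x : Fin (k + 1) → ℝ, ‖x‖ ≤ (k + 1) * R ∧ ∀ i < k + 1,
      ∃ v w : Fin (k + 1) → ℝ, dist v x < 1 / ((n : ℝ) + 1) ∧ dist w x < 1 / ((n : ℝ) + 1) ∧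
      0 ≤ F i v ∧ F i w ≤ 0 := by
    intro n
    obtain ⟨l, h1, h2, h3⟩ := key (1 / ((n : ℝ) + 1)) (by positivity)
    obtain ⟨x, hx, -⟩ := h3 0 (by omega)
    refine ⟨x, h1 x hx, fun i hi => ?_⟩
    obtain ⟨v, hv, w, hw, hvw⟩ := h3 i hi
    have hz : ∀ a : ZMod 2, a = 0 ∨ a = 1 := by decide
    rcases hz (p i v) with ha | ha <;> rcases hz (p i w) with hb | hb
    · exact absurd (ha.trans hb.symm) hvw
    · exact ⟨w, v, h2 _ hw _ hx, h2 _ hv _ hx, hp1 i w hb, hp0 i v ha⟩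
    · exact ⟨v, w, h2 _ hv _ hx, h2 _ hw _ hx, hp1 i v ha, hp0 i w hb⟩
    · exact absurd (ha.trans hb.symm) hvw
  choose x hxb hx using hkey
  obtain ⟨a, -, φ, hφ, hlim⟩ := (isCompact_closedBall (0 : Fin (k + 1) → ℝ)
    ((k + 1) * R)).tendsto_subseq (x := x) (fun n => by simpa using hxb n)
  have hzero : ∀ i < k + 1, F i a = 0 := by
    intro i hi
    choose v w hv hw hFv hFw using fun n => hx n i hi
    have h1 : Tendsto (fun n : ℕ => 1 / (((φ n : ℕ) : ℝ) + 1)) atTop (nhds 0) :=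
      tendsto_one_div_add_atTop_nhds_zero_nat.comp hφ.tendsto_atTop
    have h2 : Tendsto (fun n => v (φ n)) atTop (nhds a) := by
      refine (tendsto_iff_of_dist (squeeze_zero (fun _ => dist_nonneg)
        (fun n => (hv (φ n)).le) h1)).mpr hlim
    have h3 : Tendsto (fun n => w (φ n)) atTop (nhds a) := by
      refine (tendsto_iff_of_dist (squeeze_zero (fun _ => dist_nonneg)
        (fun n => (hw (φ n)).le) h1)).mpr hlim
    apply le_antisymm
    · exact le_of_tendsto (((hF i).tendsto a).comp h3) (Eventually.of_forall fun n => hFw (φ n))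
    · exact ge_of_tendsto (((hF i).tendsto a).comp h2) (Eventually.of_forall fun n => hFv (φ n))
  refine ⟨a, ?_, fun i hi => hzero (i + 1) (by omega)⟩
  have := hzero 0 (by omega)
  simpa [F] using this

end bu
end SMP

namespace SMP
section defo

lemma ext_zero_continuous {X E : Type*} [PseudoMetricSpace X] [NormedAddCommGroup E] {U : Set X}
    (hU : IsOpen U) (f : U → E) (hf : Continuous f)
    (hb : ∀ u : U, ‖f u‖ ≤ Metric.infDist (u : X) Uᶜ) (F : X → E) (hF : ∀ u : U, F u = f u)
    (hF0 : ∀ x, x ∉ U → F x = 0) : Continuous F := by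
  rw [continuous_iff_continuousAt]
  intro x
  by_cases hx : x ∈ U
  · have h := (hU.isOpenEmbedding_subtypeVal.continuousAt_iff (g := F) (x := ⟨x, hx⟩))
    refine h.mp ?_
    have : F ∘ Subtype.val = f := funext hF
    rw [this]
    exact hf.continuousAt
  · have h0 : Metric.infDist x Uᶜ = 0 := Metric.infDist_zero_of_mem hx
    have h1 : Tendsto (fun y => Metric.infDist y Uᶜ) (nhds x) (nhds 0) := by
      have := (Metric.continuous_infDist_pt Uᶜ).tendsto x
      rwa [h0] at this
    rw [ContinuousAt, hF0 x hx]
    refine squeeze_zero_norm (fun y => ?_) h1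
    by_cases hy : y ∈ U
    · rw [hF ⟨y, hy⟩]; exact hb ⟨y, hy⟩
    · rw [hF0 y hy, norm_zero]; exact Metric.infDist_nonneg

variable {X : Type*} [NormedAddCommGroup X] [NormedSpace ℝ X]

lemma fderiv_neg_of_even {J : X → ℝ} (heven : ∀ u, J (-u) = J u) (u : X) :
    fderiv ℝ J (-u) = - fderiv ℝ J u := by
  have h := (ContinuousLinearEquiv.neg ℝ : X ≃L[ℝ] X).comp_right_fderiv (f := J) (x := u)
  have h2 : J ∘ (ContinuousLinearEquiv.neg ℝ : X ≃L[ℝ] X) = J := funext heven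
  rw [h2] at h
  rw [h]
  ext x
  simp

theorem exists_step (J : X → ℝ) (hJ : ContDiff ℝ 1 J) (hJ0 : J 0 = 0)
    (heven : ∀ u : X, J (-u) = J u) :
    ∃ (w : X → X) (τ : X → ℝ), Continuous w ∧ Continuous τ ∧ (∀ u, w (-u) = - w u) ∧
      (∀ u, 0 ≤ τ u) ∧ (∀ u, ‖w u‖ ≤ τ u) ∧ (∀ u, 0 < J u → fderiv ℝ J u ≠ 0 → 0 < τ u) ∧
      (∀ u, J u ≤ 0 → w u = 0) ∧
      ∀ (u : X) (t : ℝ), 0 ≤ t → t ≤ 1 → J (u - t • w u) ≤ J u - t * τ u * ‖fderiv ℝ J u‖ / 4 := by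
  classical
  have hdc : Continuous (fderiv ℝ J) := hJ.continuous_fderiv (by norm_num)
  have hJc : Continuous J := hJ.continuous
  set U : Set X := {u | 0 < J u ∧ fderiv ℝ J u ≠ 0} with hUdef
  have hU : IsOpen U := (isOpen_lt continuous_const hJc).inter (isOpen_ne_fun hdc continuous_const)
  have hneg : ∀ u, u ∈ U → -u ∈ U := by
    rintro u ⟨h1, h2⟩
    refine ⟨by rwa [heven], ?_⟩
    rw [fderiv_neg_of_even heven]
    exact neg_ne_zero.mpr h2
  let n : U → U := fun u => ⟨-u, hneg u u.2⟩
  have hn : Continuous n := by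
    exact Continuous.subtype_mk (continuous_subtype_val.neg) _
  have hnn : ∀ u, n (n u) = u := fun u => Subtype.ext (neg_neg _)
  -- pseudo-gradient directions
  obtain ⟨v0, hv0⟩ : ∃ v0 : C(U, X), ∀ u : U, v0 u ∈
      {x : X | ‖x‖ ≤ 1 ∧ ‖fderiv ℝ J u‖ / 2 < fderiv ℝ J u x} := by
    refine exists_continuous_forall_mem_convex_of_local_const (fun u => ?_) (fun u => ?_)
    · intro x hx y hy a b ha hb hab
      refine ⟨?_, ?_⟩
      · have := (convex_closedBall (0 : X) 1) (x := x) (by simpa using hx.1) (y := y)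
          (by simpa using hy.1) ha hb hab
        simpa using this
      · have h1 := hx.2
        have h2 := hy.2
        simp only [map_add, map_smul, smul_eq_mul]
        rcases ha.eq_or_lt with rfl | ha'
        · have : b = 1 := by linarith
          subst this; linarith
        · have h3 : a * (‖fderiv ℝ J u‖ / 2) < a * fderiv ℝ J u x := by gcongr
          have h4 : b * (‖fderiv ℝ J u‖ / 2) ≤ b * fderiv ℝ J u y := by gcongr
          calc ‖fderiv ℝ J u‖ / 2 = a * (‖fderiv ℝ J u‖ / 2) + b * (‖fderiv ℝ J u‖ / 2) := by
                rw [← add_mul, hab, one_mul]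
            _ < _ := by linarith
    · have hpos : 0 < ‖fderiv ℝ J u‖ := norm_pos_iff.mpr u.2.2
      obtain ⟨x, hx1, hx2⟩ := (fderiv ℝ J u).exists_lt_apply_of_lt_opNorm
        (show ‖fderiv ℝ J u‖ / 2 < ‖fderiv ℝ J u‖ by linarith)
      obtain ⟨y, hy1, hy2⟩ : ∃ y : X, ‖y‖ ≤ 1 ∧ ‖fderiv ℝ J u‖ / 2 < fderiv ℝ J u y := by
        rw [Real.norm_eq_abs] at hx2
        rcases abs_cases (fderiv ℝ J u x) with h | h
        · exact ⟨x, hx1.le, by rwa [h.1] at hx2⟩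
        · exact ⟨-x, by rw [norm_neg]; exact hx1.le, by rw [map_neg, ← h.1]; exact hx2⟩
      refine ⟨y, ?_⟩
      have hd' : Continuous (fun z : U => fderiv ℝ J z) := hdc.comp continuous_subtype_val
      have : ∀ᶠ z : U in nhds u, ‖fderiv ℝ J z‖ / 2 < fderiv ℝ J z y :=
        (isOpen_lt (hd'.norm.div_const 2) (hd'.clm_apply continuous_const)).mem_nhds hy2
      filter_upwards [this] with z hz
      exact ⟨hy1, hz⟩
  let v : U → X := fun u => (1 / 2 : ℝ) • (v0 u - v0 (n u))
  have hvc : Continuous v := by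
    exact (v0.continuous.sub (v0.continuous.comp hn)).const_smul (1 / 2 : ℝ)
  have hvodd : ∀ u, v (n u) = - v u := by
    intro u
    simp only [v, hnn]
    rw [← smul_neg, neg_sub]
  have hv1 : ∀ u, ‖v u‖ ≤ 1 := by
    intro u
    have h1 := (hv0 u).1
    have h2 := (hv0 (n u)).1
    simp only [v, norm_smul]
    have h3 := norm_sub_le (v0 u) (v0 (n u))
    rw [Real.norm_of_nonneg (by norm_num)]
    linarith
  have hv2 : ∀ u : U, ‖fderiv ℝ J u‖ / 2 < fderiv ℝ J u (v u) := by
    intro u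
    have h1 := (hv0 u).2
    have h2 := (hv0 (n u)).2
    have h3 : fderiv ℝ J ((n u : U) : X) = - fderiv ℝ J u := fderiv_neg_of_even heven u
    rw [h3, norm_neg] at h2
    simp only [v, map_smul, map_sub, smul_eq_mul]
    simp only [neg_apply] at h2
    linarith
  -- step sizes
  obtain ⟨τ0, hτ0⟩ : ∃ τ0 : C(U, ℝ), ∀ u : U, τ0 u ∈ {r : ℝ | 0 < r ∧ ∀ s, 0 ≤ s → s ≤ r →
      J ((u : X) - s • v u) ≤ J u - s * ‖fderiv ℝ J u‖ / 4} := by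
    refine exists_continuous_forall_mem_convex_of_local_const (fun u => ?_) (fun u => ?_)
    · apply Set.OrdConnected.convex
      constructor
      rintro x hx y hy z ⟨hz1, hz2⟩
      exact ⟨hx.1.trans_le hz1, fun s h1 h2 => hy.2 s h1 (h2.trans hz2)⟩
    · set d := ‖fderiv ℝ J u‖ with hd
      have hpos : 0 < d := norm_pos_iff.mpr u.2.2
      have hs : HasStrictFDerivAt J (fderiv ℝ J u) (u : X) :=
        hJ.contDiffAt.hasStrictFDerivAt (by norm_num)
      have hlo := hs.isLittleO.def (show 0 < d / 8 by positivity)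
      rw [Metric.eventually_nhds_iff] at hlo
      obtain ⟨r, hr, hlo⟩ := hlo
      refine ⟨r / 4, ?_⟩
      have e1 : ∀ᶠ y : U in nhds u, dist y u < r / 4 :=
        Metric.eventually_nhds_iff.mpr ⟨r / 4, by positivity, fun {y} h => h⟩
      have e2 : ∀ᶠ y : U in nhds u, d / 2 < fderiv ℝ J u (v y) :=
        (isOpen_lt continuous_const ((fderiv ℝ J u).continuous.comp hvc)).mem_nhds (hv2 u)
      have e3 : ∀ᶠ y : U in nhds u, ‖fderiv ℝ J y‖ < 3 / 2 * d := by
        refine (isOpen_lt ((hdc.comp continuous_subtype_val).norm) continuous_const).mem_nhds ?_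
        change ‖fderiv ℝ J u‖ < 3 / 2 * d
        linarith
      filter_upwards [e1, e2, e3] with y h1 h2 h3
      refine ⟨by positivity, fun s hs0 hsr => ?_⟩
      rw [Subtype.dist_eq] at h1
      have hsv : ‖s • v y‖ ≤ s := by
        rw [norm_smul, Real.norm_of_nonneg hs0]
        exact mul_le_of_le_one_right hs0 (hv1 y)
      have h4 := hlo (y := ((y : X) - s • v y, (y : X))) (by
        rw [Prod.dist_eq]
        refine max_lt ?_ (by linarith)
        change dist ((y : X) - s • v y) u < r
        have : dist ((y : X) - s • v y) y ≤ s := by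
          rw [dist_eq_norm, sub_sub_cancel_left, norm_neg]; exact hsv
        linarith [dist_triangle ((y : X) - s • v y) y u])
      simp only [sub_sub_cancel_left, norm_neg, map_neg, map_smul, smul_eq_mul,
        sub_neg_eq_add] at h4
      rw [Real.norm_eq_abs] at h4
      have h5 := (abs_le.mp h4).2
      have h6 : d / 8 * ‖s • v y‖ ≤ d / 8 * s := by gcongr
      have h7 : s * (d / 2) ≤ s * fderiv ℝ J u (v y) := by gcongr
      have h8 : s * ‖fderiv ℝ J y‖ ≤ s * (3 / 2 * d) := by gcongr
      linarith
  have hUc : (Uᶜ).Nonempty := ⟨0, fun h => by have := h.1; rw [hJ0] at this; exact lt_irrefl _ this⟩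
  let τ1 : U → ℝ := fun u => min (min (τ0 u) (τ0 (n u)))
    (min (Metric.infDist (u : X) Uᶜ) (Metric.infDist (n u : X) Uᶜ))
  have hidc : Continuous (fun u : U => Metric.infDist (u : X) Uᶜ) :=
    (Metric.continuous_infDist_pt Uᶜ).comp continuous_subtype_val
  have hτ1c : Continuous τ1 :=
    (τ0.continuous.min (τ0.continuous.comp hn)).min (hidc.min (hidc.comp hn))
  have hidpos : ∀ u : U, 0 < Metric.infDist (u : X) Uᶜ := by
    intro u
    rw [← Metric.infDist_pos_iff_notMem_closure hUc, hU.isClosed_compl.closure_eq]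
    exact fun h => h u.2
  have hτ1pos : ∀ u, 0 < τ1 u := fun u =>
    lt_min (lt_min (hτ0 u).1 (hτ0 (n u)).1) (lt_min (hidpos u) (hidpos (n u)))
  have hτ1even : ∀ u, τ1 (n u) = τ1 u := by
    intro u
    simp only [τ1, hnn]
    rw [min_comm (τ0 (n u)), min_comm (Metric.infDist ((n u : U) : X) Uᶜ)]
  have hτ1d : ∀ u : U, τ1 u ≤ Metric.infDist (u : X) Uᶜ := fun u =>
    (min_le_right _ _).trans (min_le_left _ _)
  let τ : X → ℝ := fun x => if h : x ∈ U then τ1 ⟨x, h⟩ else 0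
  let w : X → X := fun x => if h : x ∈ U then τ1 ⟨x, h⟩ • v ⟨x, h⟩ else 0
  have hτU : ∀ u : U, τ u = τ1 u := fun u => by simp [τ]
  have hwU : ∀ u : U, w u = τ1 u • v u := fun u => by simp [w]
  have hτn : ∀ x, x ∉ U → τ x = 0 := fun x h => by simp [τ, h]
  have hwn : ∀ x, x ∉ U → w x = 0 := fun x h => by simp [w, h]
  have hwb : ∀ u : U, ‖τ1 u • v u‖ ≤ τ1 u := by
    intro u
    rw [norm_smul, Real.norm_of_nonneg (hτ1pos u).le]
    exact mul_le_of_le_one_right (hτ1pos u).le (hv1 u)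
  refine ⟨w, τ, ?_, ?_, ?_, ?_, ?_, ?_, ?_, ?_⟩
  · exact ext_zero_continuous hU (fun u => τ1 u • v u) (hτ1c.smul hvc)
      (fun u => (hwb u).trans (hτ1d u)) w hwU hwn
  · exact ext_zero_continuous hU τ1 hτ1c
      (fun u => by rw [Real.norm_of_nonneg (hτ1pos u).le]; exact hτ1d u) τ hτU hτn
  · intro x
    by_cases hx : x ∈ U
    · have h1 := hwU (n ⟨x, hx⟩)
      have h2 := hwU ⟨x, hx⟩
      rw [hτ1even, hvodd] at h1
      change w (-x) = _ at h1
      rw [h1, h2, smul_neg]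
    · have hx' : -x ∉ U := fun h => hx (by simpa using hneg _ h)
      rw [hwn x hx, hwn _ hx', neg_zero]
  · intro x
    by_cases hx : x ∈ U
    · rw [hτU ⟨x, hx⟩]; exact (hτ1pos _).le
    · rw [hτn x hx]
  · intro x
    by_cases hx : x ∈ U
    · rw [hτU ⟨x, hx⟩, hwU ⟨x, hx⟩]; exact hwb _
    · rw [hτn x hx, hwn x hx, norm_zero]
  · intro x h1 h2
    rw [hτU ⟨x, h1, h2⟩]; exact hτ1pos _
  · intro x hx
    exact hwn x (fun h => absurd h.1 (not_lt.mpr hx))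
  · intro x t ht0 ht1
    by_cases hx : x ∈ U
    · rw [hτU ⟨x, hx⟩, hwU ⟨x, hx⟩, smul_smul]
      refine (hτ0 ⟨x, hx⟩).2 _ (mul_nonneg ht0 (hτ1pos _).le) ?_
      calc t * τ1 ⟨x, hx⟩ ≤ τ1 ⟨x, hx⟩ := mul_le_of_le_one_left (hτ1pos _).le ht1
        _ ≤ τ0 ⟨x, hx⟩ := (min_le_left _ _).trans (min_le_left _ _)
    · rw [hτn x hx, hwn x hx]; simp

noncomputable def Phi (w : X → X) : ℕ → ℝ → X → X
  | 0, _, u => u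
  | n + 1, s, u => Phi w n s u - (max 0 (min 1 (s - n))) • w (Phi w n s u)

lemma Phi_continuous (w : X → X) (hw : Continuous w) (n : ℕ) :
    Continuous (fun q : ℝ × X => Phi w n q.1 q.2) := by
  induction n with
  | zero => exact continuous_snd
  | succ n ih =>
    simp only [Phi]
    fun_prop

lemma Phi_odd (w : X → X) (hw : ∀ u, w (-u) = - w u) (n : ℕ) (s : ℝ) (u : X) :
    Phi w n s (-u) = - Phi w n s u := by
  induction n with
  | zero => rfl
  | succ n ih =>
    simp only [Phi, ih, hw, smul_neg]
    abel

lemma Phi_fix (w : X → X) (u : X) (h : w u = 0) (n : ℕ) (s : ℝ) : Phi w n s u = u := by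
  induction n with
  | zero => rfl
  | succ n ih => simp [Phi, ih, h]

lemma Phi_iter (w : X → X) (n : ℕ) (s : ℝ) (hs : n ≤ s) (u : X) :
    Phi w n s u = (fun x => x - w x)^[n] u := by
  induction n with
  | zero => rfl
  | succ n ih =>
    push_cast at hs
    rw [Phi, ih (by linarith), Function.iterate_succ_apply', min_eq_left (by linarith),
      max_eq_right (by norm_num), one_smul]

lemma Phi_stable (w : X → X) (n m : ℕ) (hnm : n ≤ m) (s : ℝ) (hs : s ≤ n) (u : X) :
    Phi w m s u = Phi w n s u := by
  induction m, hnm using Nat.le_induction with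
  | base => rfl
  | succ m hm ih =>
    have : s ≤ m := hs.trans (by exact_mod_cast hm)
    rw [Phi, ih, min_eq_right (by linarith), max_eq_left (by linarith), zero_smul, sub_zero]

lemma Phi_mono (J : X → ℝ) (w : X → X)
    (hdec : ∀ (u : X) (t : ℝ), 0 ≤ t → t ≤ 1 → J (u - t • w u) ≤ J u) (n m : ℕ) (hnm : n ≤ m)
    (s : ℝ) (u : X) : J (Phi w m s u) ≤ J (Phi w n s u) := by
  induction m, hnm using Nat.le_induction with
  | base => rfl
  | succ m hm ih =>
    refine le_trans ?_ ih
    rw [Phi]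
    exact hdec _ (max 0 (min 1 (s - m))) (le_max_left _ _) (max_le (zero_le_one' ℝ) (min_le_left _ _))

theorem exists_deform (J : X → ℝ) (hJ : Continuous J)
    (w : X → X) (hw : Continuous w)
    (hodd : ∀ u, w (-u) = - w u) (hfix : ∀ u, J u ≤ 0 → w u = 0)
    (hdec : ∀ (u : X) (t : ℝ), 0 ≤ t → t ≤ 1 → J (u - t • w u) ≤ J u)
    (C : Set X) (hC : IsClosed C) (b : ℝ)
    (hreach : ∀ u ∈ C, ∃ n : ℕ, J ((fun x => x - w x)^[n] u) < b) :
    ∃ η : X → X, Continuous η ∧ (∀ u, η (-u) = - η u) ∧ (∀ u, J u ≤ 0 → η u = u) ∧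
      ∀ u ∈ C, J (η u) ≤ b := by
  have hsc : ∀ n : ℕ, Continuous ((fun x => x - w x)^[n]) := fun n =>
    (continuous_id.sub hw).iterate n
  obtain ⟨s0, hs0⟩ : ∃ s0 : C(X, ℝ), ∀ u, s0 u ∈ {r : ℝ | u ∈ C → ∃ n : ℕ, (n : ℝ) ≤ r ∧
      J ((fun x => x - w x)^[n] u) < b} := by
    refine exists_continuous_forall_mem_convex_of_local_const (fun u => ?_) (fun u => ?_)
    · apply Set.OrdConnected.convex
      constructor
      rintro x hx y hy z ⟨hz1, hz2⟩ hu
      obtain ⟨n, h1, h2⟩ := hx hu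
      exact ⟨n, h1.trans hz1, h2⟩
    · by_cases hu : u ∈ C
      · obtain ⟨n, hn⟩ := hreach u hu
        refine ⟨n, ?_⟩
        have : ∀ᶠ y in nhds u, J ((fun x => x - w x)^[n] y) < b :=
          (isOpen_lt (hJ.comp (hsc n)) continuous_const).mem_nhds hn
        filter_upwards [this] with y hy _
        exact ⟨n, le_rfl, hy⟩
      · refine ⟨0, ?_⟩
        filter_upwards [hC.isOpen_compl.mem_nhds hu] with y hy hy'
        exact absurd hy' hy
  let s : X → ℝ := fun u => max (s0 u) (s0 (-u))
  have hs : Continuous s := s0.continuous.max (s0.continuous.comp continuous_neg)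
  have hse : ∀ u, s (-u) = s u := fun u => by simp only [s, neg_neg, max_comm]
  let η : X → X := fun u => Phi w ⌈s u⌉₊ (s u) u
  have hη : ∀ u (N : ℕ), s u ≤ N → η u = Phi w N (s u) u := by
    intro u N hN
    exact (Phi_stable w _ _ (Nat.ceil_le.mpr hN) _ (Nat.le_ceil _) u).symm
  refine ⟨η, ?_, ?_, ?_, ?_⟩
  · rw [continuous_iff_continuousAt]
    intro u
    obtain ⟨N, hN⟩ := exists_nat_gt (s u)
    have h1 : ∀ᶠ y in nhds u, s y < N := (isOpen_lt hs continuous_const).mem_nhds hN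
    have h2 : ContinuousAt (fun y => Phi w N (s y) y) u :=
      ((Phi_continuous w hw N).comp (hs.prodMk continuous_id)).continuousAt
    refine h2.congr ?_
    filter_upwards [h1] with y hy
    exact (hη y N hy.le).symm
  · intro u
    simp only [η, hse, Phi_odd w hodd]
  · intro u hu
    exact Phi_fix w u (hfix u hu) _ _
  · intro u hu
    obtain ⟨n, h1, h2⟩ := hs0 u hu
    have h3 : (n : ℝ) ≤ s u := h1.trans (le_max_left _ _)
    have h4 : n ≤ ⌈s u⌉₊ := by exact_mod_cast h3.trans (Nat.le_ceil _)
    have h5 := Phi_mono J w hdec n _ h4 (s u) u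
    rw [Phi_iter w n _ h3] at h5
    exact h5.trans h2.le

end defo
end SMP

namespace SMP
section minimax
variable {X : Type*} [NormedAddCommGroup X] [NormedSpace ℝ X]

/-- The sublevel `b`, restricted to the common zeros of `k` odd functions, can be deformed
equivariantly into the sublevel `a`, keeping `{J ≤ 0}` fixed. -/
def Dfm (J : X → ℝ) (a b : ℝ) (k : ℕ) : Prop :=
  ∃ (η : X → X) (ψ : ℕ → X → ℝ), Continuous η ∧ (∀ i, Continuous (ψ i)) ∧
    (∀ u, η (-u) = - η u) ∧ (∀ i u, ψ i (-u) = - ψ i u) ∧ (∀ u, J u ≤ 0 → η u = u) ∧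
    ∀ u, J u ≤ b → (∀ i < k, ψ i u = 0) → J (η u) ≤ a

lemma Dfm.refl (J : X → ℝ) (a : ℝ) : Dfm J a a 0 :=
  ⟨id, fun _ _ => 0, continuous_id, fun _ => continuous_const, fun _ => rfl,
    fun _ _ => by simp, fun _ _ => rfl, fun _ h _ => h⟩

lemma Dfm.mono {J : X → ℝ} {a a' b b' : ℝ} {k : ℕ} (h : Dfm J a b k) (ha : a ≤ a')
    (hb : b' ≤ b) : Dfm J a' b' k := by
  obtain ⟨η, ψ, h1, h2, h3, h4, h5, h6⟩ := h
  exact ⟨η, ψ, h1, h2, h3, h4, h5, fun u hu hi => (h6 u (hu.trans hb) hi).trans ha⟩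

lemma Dfm.comp {J : X → ℝ} {a b c : ℝ} {k l : ℕ} (h : Dfm J a b k) (h' : Dfm J b c l) :
    Dfm J a c (l + k) := by
  obtain ⟨η, ψ, h1, h2, h3, h4, h5, h6⟩ := h
  obtain ⟨η', ψ', h1', h2', h3', h4', h5', h6'⟩ := h'
  refine ⟨η ∘ η', fun i => if i < l then ψ' i else ψ (i - l) ∘ η', h1.comp h1', ?_, ?_, ?_,
    ?_, ?_⟩
  · intro i
    dsimp only
    split_ifs
    · exact h2' i
    · exact (h2 _).comp h1'
  · intro u
    simp only [Function.comp, h3', h3]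
  · intro i u
    dsimp only
    split_ifs
    · exact h4' i u
    · simp only [Function.comp, h3', h4]
  · intro u hu
    simp only [Function.comp, h5' u hu, h5 u hu]
  · intro u hu hi
    refine h6 _ (h6' u hu (fun i hil => ?_)) (fun i hik => ?_)
    · have := hi i (by omega)
      simpa [hil] using this
    · have := hi (l + i) (by omega)
      simpa using this

lemma ps_limit {J : X → ℝ} (hJ : ContDiff ℝ 1 J) (hPS : PalaisSmale J) (c : ℝ) (u : ℕ → X)
    (h1 : Tendsto (fun n => J (u n)) atTop (nhds c))
    (h2 : Tendsto (fun n => ‖fderiv ℝ J (u n)‖) atTop (nhds 0)) :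
    ∃ φ : ℕ → ℕ, StrictMono φ ∧ ∃ v : X, Tendsto (fun n => u (φ n)) atTop (nhds v) ∧
      J v = c ∧ fderiv ℝ J v = 0 := by
  have hdc : Continuous (fderiv ℝ J) := hJ.continuous_fderiv (by norm_num)
  have hb : ∃ C : ℝ, ∀ n, |J (u n)| ≤ C := by
    obtain ⟨C, hC⟩ := (Metric.isBounded_range_of_tendsto _ h1).exists_norm_le
    exact ⟨C, fun n => hC _ ⟨n, rfl⟩⟩
  obtain ⟨φ, hφ, v, hv⟩ := hPS u hb h2
  refine ⟨φ, hφ, v, hv, ?_, ?_⟩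
  · exact tendsto_nhds_unique ((hJ.continuous.tendsto v).comp hv) (h1.comp hφ.tendsto_atTop)
  · have := tendsto_nhds_unique ((hdc.norm.tendsto v).comp hv) (h2.comp hφ.tendsto_atTop)
    exact norm_eq_zero.mp this

lemma exists_functionals {J : X → ℝ} (hJ : ContDiff ℝ 1 J) (hPS : PalaisSmale J)
    (hJ0 : J 0 = 0) (c : ℝ) (hc : 0 < c) :
    ∃ (k : ℕ) (ψ : ℕ → (X →L[ℝ] ℝ)),
      (∀ u, J u = c → fderiv ℝ J u = 0 → ∃ i < k, ψ i u ≠ 0) ∧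
      ((∀ u, J u = c → fderiv ℝ J u ≠ 0) → k = 0) := by
  classical
  by_cases hno : ∀ u, J u = c → fderiv ℝ J u ≠ 0
  · exact ⟨0, fun _ => 0, fun u h1 h2 => absurd h2 (hno u h1), fun _ => rfl⟩
  have hK : IsCompact {u | J u = c ∧ fderiv ℝ J u = 0} := by
    apply IsSeqCompact.isCompact
    intro u hu
    obtain ⟨φ, hφ, v, hv, h1, h2⟩ := ps_limit hJ hPS c u
      (by simp only [(hu _).1]; exact tendsto_const_nhds)
      (by simp only [(hu _).2, norm_zero]; exact tendsto_const_nhds)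
    exact ⟨v, ⟨h1, h2⟩, φ, hφ, hv⟩
  obtain ⟨t, ht⟩ := hK.elim_finite_subcover (fun f : X →L[ℝ] ℝ => {u | f u ≠ 0})
    (fun f => isOpen_ne_fun f.continuous continuous_const) (by
      rintro u ⟨hu, -⟩
      have hu0 : u ≠ 0 := by
        rintro rfl
        rw [hJ0] at hu
        exact hc.ne hu
      obtain ⟨f, -, hf⟩ := exists_dual_vector ℝ u (norm_ne_zero_iff.mpr hu0)
      refine Set.mem_iUnion.mpr ⟨f, ?_⟩
      change f u ≠ 0
      rw [hf]
      simpa using hu0)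
  refine ⟨t.toList.length, fun i => t.toList.getD i 0, ?_, fun h => absurd h hno⟩
  intro u h1 h2
  obtain ⟨f, hf⟩ := Set.mem_iUnion.mp (ht ⟨h1, h2⟩)
  obtain ⟨hft, hfu⟩ := Set.mem_iUnion.mp hf
  obtain ⟨i, hi, hif⟩ := List.getElem_of_mem (Finset.mem_toList.mpr hft)
  refine ⟨i, hi, ?_⟩
  dsimp only
  rw [List.getD_eq_getElem _ _ hi, hif]
  exact hfu

lemma exists_gap {J : X → ℝ} (hJ : ContDiff ℝ 1 J) (hPS : PalaisSmale J) (c : ℝ)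
    (W : Set X) (hW : IsClosed W) (hWK : ∀ u ∈ W, J u = c → fderiv ℝ J u ≠ 0) :
    ∃ δ > (0 : ℝ), ∀ u y, |J u - c| ≤ δ → y ∈ W → ‖u - y‖ ≤ δ → δ ≤ ‖fderiv ℝ J u‖ := by
  by_contra! hcon
  have hpos : ∀ n : ℕ, (0 : ℝ) < 1 / ((n : ℝ) + 1) := fun n => Nat.one_div_pos_of_nat
  choose u y h1 h2 h3 h4 using fun n : ℕ => hcon (1 / ((n : ℝ) + 1)) (hpos n)
  have hl : Tendsto (fun n : ℕ => 1 / ((n : ℝ) + 1)) atTop (nhds 0) :=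
    tendsto_one_div_add_atTop_nhds_zero_nat
  have t1 : Tendsto (fun n => J (u n)) atTop (nhds c) := by
    rw [tendsto_iff_norm_sub_tendsto_zero]
    exact squeeze_zero (fun _ => norm_nonneg _) h1 hl
  have t2 : Tendsto (fun n => ‖fderiv ℝ J (u n)‖) atTop (nhds 0) :=
    squeeze_zero (fun _ => norm_nonneg _) (fun n => (h4 n).le) hl
  have t3 : Tendsto (fun n => u n - y n) atTop (nhds 0) := squeeze_zero_norm h3 hl
  obtain ⟨φ, hφ, v, hv, e1, e2⟩ := ps_limit hJ hPS c u t1 t2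
  have t4 : Tendsto (fun n => y (φ n)) atTop (nhds v) := by
    have := hv.sub (t3.comp hφ.tendsto_atTop)
    simpa [Function.comp_def] using this
  exact hWK v (hW.mem_of_tendsto t4 (Eventually.of_forall fun n => h2 _)) e1 e2

theorem local_deform [CompleteSpace X] {J : X → ℝ} (hJ : ContDiff ℝ 1 J) (hPS : PalaisSmale J)
    (hJ0 : J 0 = 0) (heven : ∀ u : X, J (-u) = J u) (c : ℝ) (hc : 0 < c) :
    ∃ ε > (0 : ℝ), ∃ k, Dfm J (c - ε) (c + ε) k ∧
      ((∀ u, J u = c → fderiv ℝ J u ≠ 0) → k = 0) := by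
  obtain ⟨w, τ, hw, hτ, hwo, hτ0, hwτ, hτpos, hw0, hdec⟩ := exists_step J hJ hJ0 heven
  obtain ⟨k, ψ, hψ, hk⟩ := exists_functionals hJ hPS hJ0 c hc
  have hJc := hJ.continuous
  have hdc : Continuous (fderiv ℝ J) := hJ.continuous_fderiv (by norm_num)
  have hW : IsClosed {u : X | ∀ i < k, ψ i u = 0} := by
    simp only [Set.ofPred_forall]
    exact isClosed_iInter fun i => isClosed_iInter fun _ =>
      isClosed_eq (ψ i).continuous continuous_const
  obtain ⟨δ, hδ, hgap⟩ := exists_gap hJ hPS c _ hW (fun u hu h1 h2 => by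
    obtain ⟨i, hi, h⟩ := hψ u h1 h2
    exact h (hu i hi))
  obtain ⟨ε, hε, hε1, hε2, hε3⟩ : ∃ ε > (0 : ℝ), ε ≤ δ ∧ ε < c ∧ 8 * ε ≤ δ * δ := by
    refine ⟨min δ (min (c / 2) (δ * δ / 8)), by positivity, min_le_left _ _, ?_, ?_⟩
    · exact ((min_le_right _ _).trans (min_le_left _ _)).trans_lt (by linarith)
    · have := (min_le_right δ (min (c / 2) (δ * δ / 8))).trans (min_le_right _ _)
      linarith
  have hdec0 : ∀ (u : X) (t : ℝ), 0 ≤ t → t ≤ 1 → J (u - t • w u) ≤ J u := by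
    intro u t h0 h1
    refine (hdec u t h0 h1).trans ?_
    have : 0 ≤ t * τ u * ‖fderiv ℝ J u‖ := by
      have := hτ0 u
      positivity
    linarith
  have hCcl : IsClosed ({u | J u ≤ c + ε} ∩ {u : X | ∀ i < k, ψ i u = 0}) :=
    (isClosed_le hJc continuous_const).inter hW
  obtain ⟨η, g1, g2, g3, g4⟩ := exists_deform J hJc w hw hwo hw0 hdec0 _ hCcl (c - ε) (by
    rintro u ⟨hu1, hu2⟩
    by_contra! hcon
    set v : ℕ → X := fun n => (fun x => x - w x)^[n] u with hv
    have hv0 : v 0 = u := rfl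
    have hvs : ∀ n, v (n + 1) = v n - w (v n) := fun n => by
      simp only [hv, Function.iterate_succ_apply']
    have hstep : ∀ n, J (v (n + 1)) ≤ J (v n) - τ (v n) * ‖fderiv ℝ J (v n)‖ / 4 := by
      intro n
      have := hdec (v n) 1 zero_le_one le_rfl
      rw [one_smul, one_mul] at this
      rw [hvs]
      exact this
    have hlow : ∀ n, c - ε ≤ J (v n) := hcon
    simp only [Set.mem_ofPred_eq] at hu1
    have hg : ∀ n, (δ / 4 * ∑ i ∈ Finset.range n, τ (v i) ≤ J u - J (v n) ∧
        ‖v n - u‖ ≤ ∑ i ∈ Finset.range n, τ (v i)) →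
        (∑ i ∈ Finset.range n, τ (v i)) ≤ δ ∧ δ ≤ ‖fderiv ℝ J (v n)‖ := by
      rintro n ⟨k1, k2⟩
      have h0 : 0 ≤ ∑ i ∈ Finset.range n, τ (v i) := Finset.sum_nonneg fun i _ => hτ0 _
      have hl := hlow n
      have h3 : (∑ i ∈ Finset.range n, τ (v i)) ≤ δ := by
        refine le_of_mul_le_mul_left ?_ hδ
        linarith
      have h4 : 0 ≤ δ / 4 * ∑ i ∈ Finset.range n, τ (v i) := by positivity
      refine ⟨h3, hgap _ u ?_ hu2 (k2.trans h3)⟩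
      rw [abs_le]
      constructor <;> linarith
    have key : ∀ n, δ / 4 * ∑ i ∈ Finset.range n, τ (v i) ≤ J u - J (v n) ∧
        ‖v n - u‖ ≤ ∑ i ∈ Finset.range n, τ (v i) := by
      intro n
      induction n with
      | zero => simp [hv0]
      | succ n ih =>
        have hgr := (hg n ih).2
        have hs := hstep n
        have hm : τ (v n) * δ ≤ τ (v n) * ‖fderiv ℝ J (v n)‖ :=
          mul_le_mul_of_nonneg_left hgr (hτ0 _)
        rw [Finset.sum_range_succ]
        refine ⟨?_, ?_⟩
        · rw [mul_add]
          linarith [ih.1]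
        · have e : v (n + 1) - u = (v n - u) - w (v n) := by rw [hvs]; abel
          rw [e]
          exact (norm_sub_le _ _).trans (add_le_add ih.2 (hwτ _))
    have hgrad : ∀ n, δ ≤ ‖fderiv ℝ J (v n)‖ := fun n => (hg n (key n)).2
    have hsum : Summable (fun n => τ (v n)) :=
      summable_of_sum_range_le (c := δ) (fun n => hτ0 _) (fun n => (hg n (key n)).1)
    have hcau : CauchySeq v := by
      refine cauchySeq_of_summable_dist (Summable.of_nonneg_of_le (fun _ => dist_nonneg)
        (fun n => ?_) hsum)
      rw [hvs, dist_eq_norm, sub_sub_cancel]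
      exact hwτ _
    obtain ⟨z, hz⟩ := cauchySeq_tendsto_of_complete hcau
    have l1 : τ z = 0 := tendsto_nhds_unique ((hτ.tendsto z).comp hz) hsum.tendsto_atTop_zero
    have l2 : c - ε ≤ J z := ge_of_tendsto' ((hJc.tendsto z).comp hz) hlow
    have l3 : δ ≤ ‖fderiv ℝ J z‖ := ge_of_tendsto' ((hdc.norm.tendsto z).comp hz) hgrad
    have := hτpos z (by linarith) (norm_pos_iff.mp (by linarith))
    linarith)
  exact ⟨ε, hε, k, ⟨η, fun i => ψ i, g1, fun i => (ψ i).continuous, g2, fun i u => map_neg _ _, g3,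
    fun u h1 h2 => g4 u ⟨h1, h2⟩⟩, hk⟩

theorem chain_deform {J : X → ℝ} (G : AddSubmonoid ℕ) (a : ℝ) (b : ℝ) (hab : a ≤ b)
    (hloc : ∀ c, a ≤ c → c ≤ b → ∃ ε > (0 : ℝ), ∃ k ∈ G, Dfm J (c - ε) (c + ε) k) :
    ∃ k ∈ G, Dfm J a b k := by
  set S : Set ℝ := {t | t ≤ b ∧ ∃ k ∈ G, Dfm J a t k} with hS
  have haS : a ∈ S := ⟨hab, 0, G.zero_mem, Dfm.refl J a⟩
  have hbd : BddAbove S := ⟨b, fun t ht => ht.1⟩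
  have h1 : a ≤ sSup S := le_csSup hbd haS
  have h2 : sSup S ≤ b := csSup_le ⟨a, haS⟩ fun t ht => ht.1
  obtain ⟨ε, hε, k, hk, hD⟩ := hloc _ h1 h2
  obtain ⟨t, ⟨htb, l, hl, hDt⟩, ht⟩ := exists_lt_of_lt_csSup ⟨a, haS⟩
    (show sSup S - ε < sSup S by linarith)
  have hD' : Dfm J a (sSup S + ε) (k + l) := hDt.comp (hD.mono ht.le le_rfl)
  by_cases hb : b ≤ sSup S + ε
  · exact ⟨k + l, G.add_mem hk hl, hD'.mono le_rfl hb⟩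
  · have : sSup S + ε ≤ sSup S :=
      le_csSup hbd ⟨(not_le.mp hb).le, k + l, G.add_mem hk hl, hD'⟩
    linarith

lemma exists_injective (hinf : ¬ FiniteDimensional ℝ X) (n : ℕ) :
    ∃ L : (Fin n → ℝ) →ₗ[ℝ] X, Function.Injective L := by
  have h : (n : Cardinal) ≤ Module.rank ℝ X := by
    have : Cardinal.aleph0 ≤ Module.rank ℝ X := by
      rw [← not_lt, Module.rank_lt_aleph0_iff]
      exact hinf
    exact (Cardinal.natCast_lt_aleph0 (n := n)).le.trans this
  exact Module.le_rank_iff_exists_linearMap.mp h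

theorem no_deform (hinf : ¬ FiniteDimensional ℝ X) (J : X → ℝ) (hJ : Continuous J)
    (ρ α : ℝ) (hρ : 0 < ρ) (hα : 0 < α) (hsphere : ∀ u : X, ‖u‖ = ρ → α ≤ J u)
    (hfin : ∀ X₀ : Submodule ℝ X, FiniteDimensional ℝ X₀ →
      ∃ R > (0 : ℝ), ∀ u ∈ X₀, R ≤ ‖u‖ → J u ≤ 0) (k : ℕ)
    (hD : ∀ M, Dfm J (α / 2) M k) : False := by
  obtain ⟨L, hL⟩ := exists_injective hinf (k + 1)
  obtain ⟨R, hR, hRJ⟩ := hfin (LinearMap.range L) inferInstance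
  have hLc : Continuous L := L.continuous_of_finiteDimensional
  obtain ⟨c, hc, hanti⟩ := L.exists_antilipschitzWith (LinearMap.ker_eq_bot.mpr hL)
  have hlow : ∀ x, ‖x‖ ≤ c * ‖L x‖ := by
    intro x
    have := hanti.le_mul_dist x 0
    simpa [dist_eq_norm] using this
  set R' : ℝ := max R (ρ + 1) with hR'
  have hc0 : (0 : ℝ) < c := by exact_mod_cast hc
  have hbig : ∀ x, c * R' ≤ ‖x‖ → R' ≤ ‖L x‖ := fun x hx =>
    le_of_mul_le_mul_left (hx.trans (hlow x)) hc0
  have hbig' : ∀ x, c * R' ≤ ‖x‖ → J (L x) ≤ 0 := fun x hx =>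
    hRJ _ ⟨x, rfl⟩ ((le_max_left _ _).trans (hbig x hx))
  obtain ⟨M, hM⟩ : ∃ M, ∀ x, J (L x) ≤ M := by
    obtain ⟨M, hM⟩ := (isCompact_closedBall (0 : Fin (k + 1) → ℝ) (c * R')).bddAbove_image
      (hJ.comp hLc).continuousOn
    refine ⟨max M 0, fun x => ?_⟩
    by_cases hx : c * R' ≤ ‖x‖
    · exact (hbig' x hx).trans (le_max_right _ _)
    · refine le_trans ?_ (le_max_left _ _)
      exact hM ⟨x, by simpa using (not_le.mp hx).le, rfl⟩
  obtain ⟨η, ψ, h1, h2, h3, h4, h5, h6⟩ := hD M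
  have hη0 : η 0 = 0 := by
    have := h3 0
    rw [neg_zero] at this
    have h7 : (2 : ℝ) • η 0 = 0 := by
      rw [two_smul]
      nth_rewrite 1 [this]
      exact neg_add_cancel _
    simpa using h7
  obtain ⟨x, hx, hxi⟩ := strong_BU k (fun x => ‖η (L x)‖ - ρ) (fun i x => ψ i (L x))
    ((h1.comp hLc).norm.sub continuous_const) (fun i => (h2 i).comp hLc)
    (fun x => by simp only [map_neg, h3, norm_neg]) (fun i x => by simp only [map_neg, h4])
    (by simp only [map_zero, hη0, norm_zero]; linarith) (c * R') (fun x hx => by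
      have e1 := hbig x hx
      have e2 : ρ + 1 ≤ R' := le_max_right _ _
      rw [h5 _ (hbig' x hx)]
      linarith)
  have e1 := hsphere (η (L x)) (by linarith)
  have e2 := h6 (L x) (hM x) hxi
  linarith

theorem main [CompleteSpace X]
    (hinf : ¬ FiniteDimensional ℝ X)
    (J : X → ℝ) (hJ : ContDiff ℝ 1 J) (hPS : PalaisSmale J)
    (hJ0 : J 0 = 0) (ρ α : ℝ) (hρ : 0 < ρ) (hα : 0 < α)
    (hsphere : ∀ u : X, ‖u‖ = ρ → α ≤ J u)
    (heven : ∀ u : X, J (-u) = J u)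
    (hfin : ∀ X₀ : Submodule ℝ X, FiniteDimensional ℝ X₀ →
      ∃ R > (0 : ℝ), ∀ u ∈ X₀, R ≤ ‖u‖ → J u ≤ 0) (K : ℝ) :
    ∃ u : X, fderiv ℝ J u = 0 ∧ K ≤ J u := by
  by_contra! hno
  set b := max K (α / 2) with hb
  have hb1 : α / 2 ≤ b := le_max_right _ _
  obtain ⟨k, -, hk⟩ := chain_deform (J := J) ⊤ (α / 2) b hb1 (fun c hc _ => by
    obtain ⟨ε, hε, k, h, -⟩ := local_deform hJ hPS hJ0 heven c (by linarith)
    exact ⟨ε, hε, k, trivial, h⟩)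
  refine no_deform hinf J hJ.continuous ρ α hρ hα hsphere hfin k (fun M => ?_)
  obtain ⟨l, hl, h⟩ := chain_deform (J := J) ⊥ b (max b M) (le_max_left _ _) (fun c hc _ => by
    obtain ⟨ε, hε, k, h, h'⟩ := local_deform hJ hPS hJ0 heven c (by linarith)
    refine ⟨ε, hε, k, ?_, h⟩
    rw [AddSubmonoid.mem_bot]
    refine h' (fun u hu hu' => ?_)
    have := hno u hu'
    have := le_max_left K (α / 2)
    linarith)
  rw [AddSubmonoid.mem_bot] at hl
  subst hl
  have := hk.comp (h.mono le_rfl (le_max_right _ _))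
  rwa [zero_add] at this

end minimax
end SMP

/-- Symmetric mountain pass theorem: an even C¹ functional on an infinite-dimensional real
Banach space satisfying the Palais–Smale condition, positive on a sphere around the origin,
vanishing at `0`, and nonpositive far out on every finite-dimensional subspace, has an
unbounded sequence of critical values. -/
theorem symmetric_mountain_pass
    {X : Type*} [NormedAddCommGroup X] [NormedSpace ℝ X] [CompleteSpace X]
    (hinf : ¬ FiniteDimensional ℝ X)
    (J : X → ℝ) (hJ : ContDiff ℝ 1 J) (hPS : PalaisSmale J)
    (hJ0 : J 0 = 0) (ρ α : ℝ) (hρ : 0 < ρ) (hα : 0 < α)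
    (hsphere : ∀ u : X, ‖u‖ = ρ → α ≤ J u)
    (heven : ∀ u : X, J (-u) = J u)
    (hfin : ∀ X₀ : Submodule ℝ X, FiniteDimensional ℝ X₀ →
      ∃ R > (0 : ℝ), ∀ u ∈ X₀, R ≤ ‖u‖ → J u ≤ 0) :
    ∀ K > (0 : ℝ), ∃ u : X, fderiv ℝ J u = 0 ∧ K ≤ J u := by
  intro K _
  exact SMP.main hinf J hJ hPS hJ0 ρ α hρ hα hsphere heven hfin K
end

section
/- Let (Ω, 𝒜, μ) be a measure space and let p ∈ (1, ∞) be a real exponent. The functional Φ : L^p(μ; ℝ) → ℝ defined by Φ(u) := ∫_Ω |u|^p dμ is Fréchet differentiable at every u ∈ L^p(μ; ℝ), and its derivative is the continuous linear functional Φ′(u) : L^p(μ; ℝ) → ℝ given by Φ′(u)(v) = p ∫_Ω |u|^{p−2} u · v dμ. -/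
open MeasureTheory

lemma aux_one (p : ℝ) (hp : 1 < p) (ε : ℝ) (hε : 0 < ε) :
    ∃ C : ℝ, 0 ≤ C ∧ ∀ t : ℝ, |(|1 + t| ^ p - 1 - p * t)| ≤ ε * |t| + C * |t| ^ p := by
  have h := (hasDerivAt_abs_rpow 1 hp)
  rw [hasDerivAt_iff_isLittleO_nhds_zero, Asymptotics.isLittleO_iff] at h
  obtain ⟨δ, hδ, hb⟩ := Metric.eventually_nhds_iff.1 (h hε)
  refine ⟨(1 / δ + 1) ^ p + (1 / δ) ^ p + p * (1 / δ) ^ (p - 1), by positivity, fun t => ?_⟩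
  by_cases ht : |t| < δ
  · have := hb (y := t) (by simpa using ht)
    simp only [abs_one, Real.one_rpow, mul_one, smul_eq_mul, Real.norm_eq_abs] at this
    rw [mul_comm t p] at this
    refine this.trans (le_add_of_nonneg_right (by positivity))
  · push Not at ht
    have ht0 : 0 < |t| := hδ.trans_le ht
    have h1 : 1 ≤ 1 / δ * |t| := by
      rw [one_div, ← div_eq_inv_mul, le_div_iff₀ hδ]; linarith
    have e1 : |1 + t| ^ p ≤ (1 / δ + 1) ^ p * |t| ^ p := by
      rw [← Real.mul_rpow (by positivity) (by positivity)]
      refine Real.rpow_le_rpow (abs_nonneg _) ?_ (by linarith)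
      have := abs_add_le 1 t
      rw [abs_one] at this
      linarith
    have e2 : 1 ≤ (1 / δ) ^ p * |t| ^ p := by
      rw [← Real.mul_rpow (by positivity) (by positivity)]
      exact Real.one_le_rpow h1 (by linarith)
    have e3 : p * |t| ≤ p * (1 / δ) ^ (p - 1) * |t| ^ p := by
      have : |t| ^ p = |t| ^ (p - 1) * |t| := by
        rw [← Real.rpow_add_one ht0.ne']; ring_nf
      rw [this]
      have : 1 ≤ (1 / δ) ^ (p - 1) * |t| ^ (p - 1) := by
        rw [← Real.mul_rpow (by positivity) (by positivity)]
        exact Real.one_le_rpow h1 (by linarith)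
      have h3 : 0 < p * |t| := by positivity
      nlinarith
    have e4 : |(|1 + t| ^ p - 1 - p * t)| ≤ |1 + t| ^ p + 1 + p * |t| := by
      have a1 : 0 ≤ |1 + t| ^ p := by positivity
      have a2 := abs_le.1 (le_refl |t|)
      rw [abs_le]
      constructor <;> nlinarith
    have : 0 ≤ ε * |t| := by positivity
    linarith

lemma aux_all (p : ℝ) (hp : 1 < p) (ε : ℝ) (hε : 0 < ε) :
    ∃ C : ℝ, 0 ≤ C ∧ ∀ a h : ℝ, |(|a + h| ^ p - |a| ^ p - p * (|a| ^ (p - 2) * a * h))| ≤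
      ε * (|a| ^ (p - 1) * |h|) + C * |h| ^ p := by
  obtain ⟨C, hC, hb⟩ := aux_one p hp ε hε
  refine ⟨C + 1, by positivity, fun a h => ?_⟩
  rcases eq_or_ne a 0 with rfl | ha
  · have h0 : 0 ≤ |h| ^ p := by positivity
    simp only [zero_add, abs_zero, mul_zero, zero_mul, sub_zero]
    rw [Real.zero_rpow (by linarith), Real.zero_rpow (by linarith), sub_zero, abs_of_nonneg h0]
    nlinarith
  · have ha' : 0 < |a| := abs_pos.2 ha
    have h0 : 0 ≤ |h| ^ p := by positivity
    have key := mul_le_mul_of_nonneg_left (hb (h / a)) (show 0 ≤ |a| ^ p by positivity)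
    rw [← abs_of_pos (show 0 < |a| ^ p by positivity), ← abs_mul,
      abs_of_pos (show 0 < |a| ^ p by positivity)] at key
    have e1 : |a| ^ p * |1 + h / a| ^ p = |a + h| ^ p := by
      rw [← Real.mul_rpow (by positivity) (by positivity), ← abs_mul]
      congr 2; field_simp
    have e2 : |a| ^ p * |h / a| ^ p = |h| ^ p := by
      rw [← Real.mul_rpow (by positivity) (by positivity), ← abs_mul]
      congr 2; field_simp
    have e3 : |a| ^ p * |h / a| = |a| ^ (p - 1) * |h| := by
      rw [Real.rpow_sub_one ha'.ne', abs_div]; field_simp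
    have e4 : |a| ^ p * (h / a) = |a| ^ (p - 2) * a * h := by
      have : |a| ^ p = |a| ^ (p - 2) * (a * a) := by
        rw [← abs_mul_abs_self a, ← pow_two, ← Real.rpow_natCast, ← Real.rpow_add ha']
        norm_num
      rw [this]; field_simp
    calc _ = |(|a| ^ p * (|1 + h / a| ^ p - 1 - p * (h / a)))| := by
            congr 1; rw [← e1, ← e4]; ring
      _ ≤ _ := key
      _ = ε * (|a| ^ p * |h / a|) + C * (|a| ^ p * |h / a| ^ p) := by ring
      _ ≤ _ := by rw [e2, e3]; linarith

theorem lp_norm_pow_differentiable {Ω : Type*} [MeasurableSpace Ω] (μ : Measure Ω)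
    (p : ℝ) (hp : 1 < p) [Fact (1 ≤ ENNReal.ofReal p)] (u : Lp ℝ (ENNReal.ofReal p) μ) :
    ∃ D : Lp ℝ (ENNReal.ofReal p) μ →L[ℝ] ℝ,
      HasFDerivAt (fun w : Lp ℝ (ENNReal.ofReal p) μ => ∫ x, |w x| ^ p ∂μ) D u ∧
      ∀ v : Lp ℝ (ENNReal.ofReal p) μ, D v = p * ∫ x, |u x| ^ (p - 2) * u x * v x ∂μ := by
  have hp0 : 0 < p := by linarith
  have hP0 : ENNReal.ofReal p ≠ 0 := by simpa using hp0
  have hPr : (ENNReal.ofReal p).toReal = p := ENNReal.toReal_ofReal hp0.le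
  have hconj : p.HolderConjugate (p / (p - 1)) := Real.HolderConjugate.conjExponent hp
  have hq : ENNReal.ofReal p / ENNReal.ofReal (p - 1) = ENNReal.ofReal (p / (p - 1)) :=
    (ENNReal.ofReal_div_of_pos (by linarith)).symm
  have : ENNReal.HolderConjugate (ENNReal.ofReal p) (ENNReal.ofReal (p / (p - 1))) :=
    hconj.ennrealOfReal
  have := this.symm
  have : Fact (1 ≤ ENNReal.ofReal (p / (p - 1))) := ⟨by
    rw [ENNReal.one_le_ofReal]; exact hconj.symm.lt.le⟩
  -- `|u|^(p-1)` and `|u|^(p-2) u` lie in the dual space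
  have hg1 : MemLp (fun x => |u x| ^ (p - 1)) (ENNReal.ofReal (p / (p - 1))) μ := by
    have := (Lp.memLp u).norm_rpow_div (ENNReal.ofReal (p - 1))
    rw [hq, ENNReal.toReal_ofReal (by linarith)] at this
    exact this
  have hg2 : MemLp (fun x => |u x| ^ (p - 2) * u x) (ENNReal.ofReal (p / (p - 1))) μ := by
    refine hg1.of_le ?_ (Filter.Eventually.of_forall fun x => ?_)
    · have := (Lp.memLp u).aestronglyMeasurable.aemeasurable
      exact ((this.abs.pow_const _).mul this).aestronglyMeasurable
    · rcases eq_or_ne (u x) 0 with h | h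
      · rw [h]; simp
      · have h' : 0 < |u x| := abs_pos.2 h
        have e : |u x| ^ (p - 1) = |u x| ^ (p - 2) * |u x| := by
          rw [← Real.rpow_add_one h'.ne']; ring_nf
        simp only [Real.norm_eq_abs]
        rw [e, abs_mul, abs_mul, abs_abs]
  let B := (ContinuousLinearMap.mul ℝ ℝ).lpPairing μ (ENNReal.ofReal (p / (p - 1)))
    (ENNReal.ofReal p)
  have hB : ∀ (g : Ω → ℝ) (hg : MemLp g (ENNReal.ofReal (p / (p - 1))) μ)
      (f : Ω → ℝ) (hf : MemLp f (ENNReal.ofReal p) μ),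
      B (hg.toLp g) (hf.toLp f) = ∫ x, g x * f x ∂μ := by
    intro g hg f hf
    rw [ContinuousLinearMap.lpPairing_eq_integral]
    refine integral_congr_ae ?_
    filter_upwards [hg.coeFn_toLp, hf.coeFn_toLp] with x h1 h2
    simp [h1, h2]
  have hI : ∀ w : Lp ℝ (ENNReal.ofReal p) μ, Integrable (fun x => |w x| ^ p) μ := by
    intro w
    have := (Lp.memLp w).integrable_norm_rpow hP0 (by simp)
    rw [hPr] at this
    exact this
  have hN : ∀ w : Lp ℝ (ENNReal.ofReal p) μ, ∫ x, |w x| ^ p ∂μ = ‖w‖ ^ p := by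
    intro w
    have h1 : ‖w‖ = lpNorm w (ENNReal.ofReal p) μ := by
      rw [Lp.norm_def, toReal_eLpNorm (Lp.memLp w).aestronglyMeasurable]
    rw [h1, lpNorm_eq_integral_norm_rpow_toReal hP0 (by simp)
      (Lp.memLp w).aestronglyMeasurable, hPr, ← Real.rpow_mul, inv_mul_cancel₀ hp0.ne',
      Real.rpow_one]
    · rfl
    · exact integral_nonneg fun x => by positivity
  have hD : ∀ v : Lp ℝ (ENNReal.ofReal p) μ, (p • B (hg2.toLp _)) v =
      p * ∫ x, |u x| ^ (p - 2) * u x * v x ∂μ := by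
    intro v
    have := hB _ hg2 v (Lp.memLp v)
    rw [Lp.toLp_coeFn] at this
    rw [smul_apply, this, smul_eq_mul]
  refine ⟨p • B (hg2.toLp _), ?_, hD⟩
  set K := ‖B (hg1.toLp _)‖ with hK
  have hKb : ∀ v : Lp ℝ (ENNReal.ofReal p) μ, ∫ x, |u x| ^ (p - 1) * |v x| ∂μ ≤ K * ‖v‖ := by
    intro v
    have h1 := hB _ hg1 (fun x => ‖v x‖) (Lp.memLp v).norm
    simp only [Real.norm_eq_abs] at h1
    rw [← h1]
    refine (le_abs_self _).trans ?_
    refine ((B (hg1.toLp _)).le_opNorm _).trans (le_of_eq ?_)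
    congr 1
    rw [Lp.norm_toLp, Lp.norm_def]
    exact congrArg _ (eLpNorm_norm (fun x => v x))
  rw [hasFDerivAt_iff_isLittleO_nhds_zero, Asymptotics.isLittleO_iff]
  intro c hc
  have hK0 : 0 ≤ K := norm_nonneg _
  obtain ⟨C, hC, hb⟩ := aux_all p hp (c / (2 * (K + 1))) (by positivity)
  have hlim : Filter.Tendsto (fun v : Lp ℝ (ENNReal.ofReal p) μ => C * ‖v‖ ^ (p - 1))
      (nhds 0) (nhds 0) := by
    have : Continuous (fun v : Lp ℝ (ENNReal.ofReal p) μ => C * ‖v‖ ^ (p - 1)) :=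
      continuous_const.mul (continuous_norm.rpow_const fun _ => Or.inr (by linarith))
    have h := this.tendsto 0
    simpa [Real.zero_rpow (show p - 1 ≠ 0 by linarith)] using h
  filter_upwards [hlim.eventually (ge_mem_nhds (show 0 < c / 2 by positivity))] with v hv
  have i1 : Integrable (fun x => |u x| ^ (p - 2) * u x * v x) μ := hg2.integrable_mul (Lp.memLp v)
  have i2 : Integrable (fun x => |u x| ^ (p - 1) * |v x|) μ :=
    hg1.integrable_mul (Lp.memLp v).norm
  have e : (∫ x, |(u + v) x| ^ p ∂μ) - (∫ x, |u x| ^ p ∂μ) - (p • B (hg2.toLp _)) v =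
      ∫ x, (|u x + v x| ^ p - |u x| ^ p - p * (|u x| ^ (p - 2) * u x * v x)) ∂μ := by
    have j : ∀ᵐ x ∂μ, |(u + v) x| ^ p = |u x + v x| ^ p := by
      filter_upwards [Lp.coeFn_add u v] with x hx
      rw [hx]; rfl
    have j2 : Integrable (fun x => |u x + v x| ^ p) μ := (hI (u + v)).congr j
    have j3 : Integrable (fun x => |u x + v x| ^ p - |u x| ^ p) μ := j2.sub (hI u)
    rw [hD, integral_sub j3 (i1.const_mul p), integral_sub j2 (hI u),
      integral_const_mul, integral_congr_ae j]
  rw [e]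
  calc _ ≤ ∫ x, (c / (2 * (K + 1)) * (|u x| ^ (p - 1) * |v x|) + C * |v x| ^ p) ∂μ :=
        norm_integral_le_of_norm_le ((i2.const_mul _).add ((hI v).const_mul _))
          (Filter.Eventually.of_forall fun x => hb (u x) (v x))
    _ = c / (2 * (K + 1)) * (∫ x, |u x| ^ (p - 1) * |v x| ∂μ) + C * ‖v‖ ^ p := by
        rw [integral_add (i2.const_mul _) ((hI v).const_mul _), integral_const_mul,
          integral_const_mul, hN]
    _ ≤ c / (2 * (K + 1)) * (K * ‖v‖) + C * ‖v‖ ^ p := by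
        gcongr; exact hKb v
    _ ≤ c / 2 * ‖v‖ + c / 2 * ‖v‖ := by
        gcongr ?_ + ?_
        · rw [← mul_assoc]
          gcongr
          rw [div_mul_eq_mul_div, div_le_div_iff₀ (by positivity) (by positivity)]
          nlinarith
        · have : ‖v‖ ^ p = ‖v‖ ^ (p - 1) * ‖v‖ := by
            rw [← Real.rpow_add_one' (norm_nonneg _) (by linarith)]; ring_nf
          rw [this, ← mul_assoc]
          gcongr
    _ = c * ‖v‖ := by ring
end
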